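/- arXiv:1610.09474 — 5 statements merged into one kernel-verified Lean document; each statement's English description precedes it below -/
import Mathlib

section
/- Let k ≥ 5 be a natural number and let h_k be a nonzero homogeneous harmonic polynomial of degree k in the two real variables x, y. For each s ∈ {1, 2, …, k−4} define σ_s = s+1 if s < (k−3)/2 and σ_s = s+2 if s ≥ (k−3)/2, and let ρ_{k+s} be a homogeneous real polynomial of degree k+s satisfying Δ^{σ_s} ρ_{k+s} = 0. Let R ∈ m₂^{2k−3}. Then the smooth function-germs h_k and h_k + Σ_{s=1}^{k−4} ρ_{k+s} + R at 0 ∈ ℝ² are right equivalent. -/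
open MvPolynomial Filter Topology

/-- The Laplacian on polynomials in two variables. -/
noncomputable def pLap (p : MvPolynomial (Fin 2) ℝ) : MvPolynomial (Fin 2) ℝ :=
  pderiv 0 (pderiv 0 p) + pderiv 1 (pderiv 1 p)

/-- The smooth function on `ℝ²` defined by a polynomial. -/
noncomputable def toFun2 (p : MvPolynomial (Fin 2) ℝ) : ℝ × ℝ → ℝ :=
  fun q => eval ![q.1, q.2] p

/-- `R` belongs to `m₂^k`: all partial derivatives of order `< k` vanish at `0`. -/
def VanishTo (k : ℕ) (R : ℝ × ℝ → ℝ) : Prop :=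
  ∀ j, j < k → iteratedFDeriv ℝ j R 0 = 0

/-- Right equivalence of function-germs at `0 ∈ ℝ²`: there is a diffeomorphism-germ
`φ : (ℝ²,0) → (ℝ²,0)` with `h₁ ∘ φ = h₂` as germs. -/
def RightEquiv (h₁ h₂ : ℝ × ℝ → ℝ) : Prop :=
  ∃ φ ψ : ℝ × ℝ → ℝ × ℝ,
    ContDiffAt ℝ (⊤ : ℕ∞) φ 0 ∧ ContDiffAt ℝ (⊤ : ℕ∞) ψ 0 ∧ φ 0 = 0 ∧ ψ 0 = 0 ∧
    (ψ ∘ φ =ᶠ[nhds 0] id) ∧ (φ ∘ ψ =ᶠ[nhds 0] id) ∧ (h₁ ∘ φ =ᶠ[nhds 0] h₂)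


section Calculus

variable {X : Type*} [NormedAddCommGroup X] [NormedSpace ℝ X]

/-- Functions that are sums of degree `N` monomials in `z, conj z` with smooth coefficients. -/
def HasOrd (z : X → ℂ) (x0 : X) (N : ℕ) (F : X → ℂ) : Prop :=
  ∃ g : ℕ → X → ℂ, (∀ i, ContDiffAt ℝ (⊤ : ℕ∞) (g i) x0) ∧
    ∀ x, F x = ∑ i ∈ Finset.range (N + 1),
      z x ^ i * (starRingEnd ℂ (z x)) ^ (N - i) * g i x

theorem smooth_conj {x0 : X} {g : X → ℂ} (hg : ContDiffAt ℝ (⊤ : ℕ∞) g x0) :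
    ContDiffAt ℝ (⊤ : ℕ∞) (fun x => starRingEnd ℂ (g x)) x0 :=
  (Complex.conjCLE.contDiff.contDiffAt (x := g x0)).comp x0 hg

variable {z : X → ℂ} {x0 : X}

theorem smooth_mono (hz : ContDiffAt ℝ (⊤ : ℕ∞) z x0) {g : X → ℂ}
    (hg : ContDiffAt ℝ (⊤ : ℕ∞) g x0) (A B : ℕ) :
    ContDiffAt ℝ (⊤ : ℕ∞) (fun x => z x ^ A * (starRingEnd ℂ (z x)) ^ B * g x) x0 :=
  ((hz.pow A).mul ((smooth_conj hz).pow B)).mul hg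

theorem HasOrd.smooth (hz : ContDiffAt ℝ (⊤ : ℕ∞) z x0) {N : ℕ} {F : X → ℂ}
    (hF : HasOrd z x0 N F) : ContDiffAt ℝ (⊤ : ℕ∞) F x0 := by
  obtain ⟨g, hg, hF⟩ := hF
  rw [show F = _ from funext hF]
  exact ContDiffAt.sum fun i _ => smooth_mono hz (hg i) _ _

theorem hasOrd_zero {F : X → ℂ} (hF : ContDiffAt ℝ (⊤ : ℕ∞) F x0) : HasOrd z x0 0 F :=
  ⟨fun _ => F, fun _ => hF, fun x => by simp⟩

theorem HasOrd.add {N : ℕ} {F G : X → ℂ} (hF : HasOrd z x0 N F) (hG : HasOrd z x0 N G) :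
    HasOrd z x0 N (fun x => F x + G x) := by
  obtain ⟨f, hf, hF⟩ := hF
  obtain ⟨g, hg, hG⟩ := hG
  refine ⟨fun i x => f i x + g i x, fun i => (hf i).add (hg i), fun x => ?_⟩
  beta_reduce
  rw [hF, hG, ← Finset.sum_add_distrib]
  exact Finset.sum_congr rfl fun i _ => by ring

theorem HasOrd.of_zero (N : ℕ) : HasOrd z x0 N (fun _ => 0) :=
  ⟨fun _ _ => 0, fun _ => contDiffAt_const, fun x => by simp⟩

theorem HasOrd.sum {ι : Type*} {N : ℕ} (s : Finset ι) {F : ι → X → ℂ}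
    (hF : ∀ i ∈ s, HasOrd z x0 N (F i)) :
    HasOrd z x0 N (fun x => ∑ i ∈ s, F i x) := by
  classical
  induction s using Finset.induction_on with
  | empty => simpa using HasOrd.of_zero N
  | insert a s ha ih =>
    simp only [Finset.sum_insert ha]
    exact (hF a (by simp)).add (ih fun i hi => hF i (by simp [hi]))

theorem hasOrd_mono_exact {N i : ℕ} (hi : i ≤ N) {g : X → ℂ}
    (hg : ContDiffAt ℝ (⊤ : ℕ∞) g x0) :
    HasOrd z x0 N (fun x => z x ^ i * (starRingEnd ℂ (z x)) ^ (N - i) * g x) := by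
  refine ⟨fun j => if j = i then g else fun _ => 0, fun j => ?_, fun x => ?_⟩
  · by_cases h : j = i
    · simpa [h] using hg
    · simpa [h] using contDiffAt_const
  · rw [Finset.sum_eq_single i]
    · simp
    · intro b _ hb
      simp [hb]
    · intro h
      exact absurd (Finset.mem_range.2 (by omega)) h

theorem hasOrd_mono (hz : ContDiffAt ℝ (⊤ : ℕ∞) z x0) {N A B : ℕ} (hN : N ≤ A + B) {g : X → ℂ}
    (hg : ContDiffAt ℝ (⊤ : ℕ∞) g x0) :
    HasOrd z x0 N (fun x => z x ^ A * (starRingEnd ℂ (z x)) ^ B * g x) := by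
  have := hasOrd_mono_exact (z := z) (x0 := x0) (N := N) (i := min A N) (min_le_right _ _)
    (smooth_mono hz hg (A - min A N) (B - (N - min A N)))
  convert this using 2 with x
  have h1 : z x ^ A = z x ^ (min A N) * z x ^ (A - min A N) := by
    rw [← pow_add]; congr 1; omega
  have h2 : (starRingEnd ℂ (z x)) ^ B = (starRingEnd ℂ (z x)) ^ (N - min A N) *
      (starRingEnd ℂ (z x)) ^ (B - (N - min A N)) := by
    rw [← pow_add]; congr 1; omega
  rw [h1, h2]; ring

theorem HasOrd.mono (hz : ContDiffAt ℝ (⊤ : ℕ∞) z x0) {N M : ℕ} (hNM : N ≤ M) {F : X → ℂ}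
    (hF : HasOrd z x0 M F) : HasOrd z x0 N F := by
  obtain ⟨g, hg, hF⟩ := hF
  rw [show F = _ from funext hF]
  refine HasOrd.sum _ fun i hi => hasOrd_mono hz ?_ (hg i)
  have := Finset.mem_range.1 hi
  omega

theorem HasOrd.mul (hz : ContDiffAt ℝ (⊤ : ℕ∞) z x0) {N M : ℕ} {F G : X → ℂ}
    (hF : HasOrd z x0 N F) (hG : HasOrd z x0 M G) :
    HasOrd z x0 (N + M) (fun x => F x * G x) := by
  obtain ⟨f, hf, hF⟩ := hF
  obtain ⟨g, hg, hG⟩ := hG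
  have : (fun x => F x * G x) = fun x => ∑ i ∈ Finset.range (N + 1), ∑ j ∈ Finset.range (M + 1),
      z x ^ (i + j) * (starRingEnd ℂ (z x)) ^ ((N - i) + (M - j)) * (f i x * g j x) := by
    funext x
    rw [hF, hG, Finset.sum_mul_sum]
    refine Finset.sum_congr rfl fun i _ => Finset.sum_congr rfl fun j _ => ?_
    rw [pow_add, pow_add]; ring
  rw [this]
  refine HasOrd.sum _ fun i hi => HasOrd.sum _ fun j hj => hasOrd_mono hz ?_ ((hf i).mul (hg j))
  have := Finset.mem_range.1 hi
  have := Finset.mem_range.1 hj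
  omega

theorem HasOrd.smul (hz : ContDiffAt ℝ (⊤ : ℕ∞) z x0) {M : ℕ} {F G : X → ℂ}
    (hF : ContDiffAt ℝ (⊤ : ℕ∞) F x0) (hG : HasOrd z x0 M G) :
    HasOrd z x0 M (fun x => F x * G x) := by
  simpa using (hasOrd_zero hF).mul hz hG

theorem HasOrd.pow (hz : ContDiffAt ℝ (⊤ : ℕ∞) z x0) {N : ℕ} {F : X → ℂ}
    (hF : HasOrd z x0 N F) (j : ℕ) :
    HasOrd z x0 (j * N) (fun x => F x ^ j) := by
  induction j with
  | zero => simpa using hasOrd_zero (z := z) (x0 := x0) contDiffAt_const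
  | succ j ih =>
    simp only [pow_succ, Nat.succ_mul]
    exact ih.mul hz hF

theorem hasOrd_z (hz : ContDiffAt ℝ (⊤ : ℕ∞) z x0) : HasOrd z x0 1 z := by
  simpa using hasOrd_mono (x0 := x0) (N := 1) (A := 1) (B := 0) hz le_rfl
    (g := fun _ => 1) contDiffAt_const

theorem hasOrd_conj (hz : ContDiffAt ℝ (⊤ : ℕ∞) z x0) :
    HasOrd z x0 1 (fun x => starRingEnd ℂ (z x)) := by
  simpa using hasOrd_mono (x0 := x0) (N := 1) (A := 0) (B := 1) hz le_rfl
    (g := fun _ => 1) contDiffAt_const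

theorem HasOrd.eq_zero {N : ℕ} (hN : N ≠ 0) {F : X → ℂ} (hF : HasOrd z x0 N F) {x : X}
    (hx : z x = 0) : F x = 0 := by
  obtain ⟨g, hg, hF⟩ := hF
  rw [hF, hx]
  refine Finset.sum_eq_zero fun i hi => ?_
  by_cases h : i = 0
  · subst h; simp [hN]
  · simp [h]

/-- Splitting off degree `d` monomials. -/
theorem HasOrd.split (hz : ContDiffAt ℝ (⊤ : ℕ∞) z x0) {d : ℕ} {F : X → ℂ}
    (hF : HasOrd z x0 (d + 1) F) :
    ∃ g : ℕ → X → ℂ, (∀ i, HasOrd z x0 1 (g i)) ∧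
    ∀ x, F x = ∑ i ∈ Finset.range (d + 1),
      z x ^ i * (starRingEnd ℂ (z x)) ^ (d - i) * g i x := by
  obtain ⟨g, hg, hF⟩ := hF
  refine ⟨fun i x => g i x * starRingEnd ℂ (z x) + (if i = d then g (d + 1) x else 0) * z x,
    fun i => (HasOrd.smul hz (hg i) (hasOrd_conj hz)).add (HasOrd.smul hz ?_ (hasOrd_z hz)),
    fun x => ?_⟩
  · by_cases h : i = d
    · simpa [h] using hg (d + 1)
    · simpa [h] using contDiffAt_const
  · rw [hF, Finset.sum_range_succ]
    simp only [mul_add, Finset.sum_add_distrib]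
    congr 1
    · refine Finset.sum_congr rfl fun i hi => ?_
      have := Finset.mem_range.1 hi
      rw [show d + 1 - i = (d - i) + 1 by omega, pow_succ]; ring
    · rw [Finset.sum_eq_single d]
      · simp [pow_succ]; ring
      · intro b _ hb
        simp [hb]
      · simp

/-- Taking real parts, one may move the large exponent onto `z`. -/
theorem re_factor (hz : ContDiffAt ℝ (⊤ : ℕ∞) z x0) (m l : ℕ) (g : ℕ → X → ℂ)
    (hg : ∀ i, ContDiffAt ℝ (⊤ : ℕ∞) (g i) x0)
    (h0 : ∀ i, i < m → l < i → ∀ x, g i x = 0) :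
    ∃ G : X → ℂ, HasOrd z x0 l G ∧ ∀ x, (∑ i ∈ Finset.range (m + l + 1),
      z x ^ i * (starRingEnd ℂ (z x)) ^ (m + l - i) * g i x).re = (z x ^ m * G x).re := by
  refine ⟨fun x => ∑ i ∈ Finset.range (m + l + 1), if m ≤ i then
      z x ^ (i - m) * (starRingEnd ℂ (z x)) ^ (m + l - i) * g i x else if i ≤ l then
      z x ^ (l - i) * (starRingEnd ℂ (z x)) ^ i * starRingEnd ℂ (g i x) else 0,
      HasOrd.sum _ fun i hi => ?_, fun x => ?_⟩
  · have := Finset.mem_range.1 hi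
    split_ifs with h1 h2
    · exact hasOrd_mono hz (by omega) (hg i)
    · exact hasOrd_mono hz (by omega) (smooth_conj (hg i))
    · exact HasOrd.of_zero l
  · rw [Finset.mul_sum, Complex.re_sum, Complex.re_sum]
    refine Finset.sum_congr rfl fun i hi => ?_
    split_ifs with h1 h2
    · congr 1
      obtain ⟨a, rfl⟩ := Nat.exists_eq_add_of_le h1
      rw [Nat.add_sub_cancel_left, pow_add]; ring
    · rw [← Complex.conj_re]
      congr 1
      simp only [map_mul, map_pow, Complex.conj_conj]
      rw [show m + l - i = m + (l - i) by omega, pow_add]; ring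
    · rw [h0 i (by omega) (by omega)]; simp

/-- Functions of order at least `2m-1` : real part version. -/
theorem HasOrd.re_factor (hz : ContDiffAt ℝ (⊤ : ℕ∞) z x0) {m l : ℕ} (hml : m ≤ l + 1)
    {F : X → ℂ} (hF : HasOrd z x0 (m + l) F) :
    ∃ G : X → ℂ, HasOrd z x0 l G ∧ ∀ x, (F x).re = (z x ^ m * G x).re := by
  obtain ⟨g, hg, hF⟩ := hF
  obtain ⟨G, hG, h⟩ := _root_.re_factor hz m l g hg (fun i h1 h2 => by omega)
  exact ⟨G, hG, fun x => by rw [hF, h]⟩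

end Calculus

section Hadamard

variable {E : Type} [NormedAddCommGroup E] [NormedSpace ℝ E] [FiniteDimensional ℝ E]

/-- Averages along rays of a `C^n` function are `C^n`. -/
theorem contDiff_avg (n : ℕ) : ∀ {F : Type} [NormedAddCommGroup F] [NormedSpace ℝ F]
    (f : E → F) (_ : ContDiff ℝ n f) (w : ℝ → ℝ) (_ : Continuous w),
    ContDiff ℝ n (fun q => ∫ t in (0:ℝ)..1, w t • f (t • q)) := by
  induction n with
  | zero =>
    intro F _ _ f hf w hw
    have hfc := hf.continuous
    refine contDiff_zero.2 ?_
    refine intervalIntegral.continuous_parametric_intervalIntegral_of_continuous' ?_ 0 1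
    fun_prop
  | succ n ih =>
    intro F _ _ f hf w hw
    have hfc := hf.continuous
    have hf1 : Differentiable ℝ f := hf.differentiable (by simp)
    have hf' : ContDiff ℝ n (fderiv ℝ f) := hf.fderiv_right (by simp)
    have hfc' := hf'.continuous
    refine (contDiff_succ_iff_hasFDerivAt (n := n)).2
      ⟨fun q => ∫ t in (0:ℝ)..1, (w t * t) • fderiv ℝ f (t • q),
      ih (fderiv ℝ f) hf' (fun t => w t * t) (by fun_prop), fun q0 => ?_⟩
    have hcont : Continuous (fun p : ℝ × E => (w p.1 * p.1) • fderiv ℝ f (p.1 • p.2)) := by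
      fun_prop
    obtain ⟨C, hC⟩ := ((isCompact_Icc (a := (0:ℝ)) (b := 1)).prod
      (isCompact_closedBall q0 1)).exists_bound_of_continuousOn hcont.continuousOn
    refine (intervalIntegral.hasFDerivAt_integral_of_dominated_of_fderiv_le
      (F := fun q t => w t • f (t • q)) (F' := fun q t => (w t * t) • fderiv ℝ f (t • q))
      (bound := fun _ => C) (s := Metric.ball q0 1) (Metric.ball_mem_nhds q0 one_pos) ?_ ?_ ?_ ?_ ?_ ?_)
    · exact Eventually.of_forall fun q => (by fun_prop : Continuous
        fun t => w t • f (t • q)).aestronglyMeasurable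
    · exact (by fun_prop : Continuous fun t => w t • f (t • q0)).intervalIntegrable _ _
    · exact (by fun_prop : Continuous
        fun t => (w t * t) • fderiv ℝ f (t • q0)).aestronglyMeasurable
    · refine Eventually.of_forall fun t ht q hq => ?_
      rw [Set.uIoc_of_le zero_le_one] at ht
      exact hC (t, q) ⟨⟨ht.1.le, ht.2⟩, Metric.ball_subset_closedBall hq⟩
    · exact intervalIntegrable_const
    · refine Eventually.of_forall fun t ht q hq => ?_
      have h1 : HasFDerivAt (fun q : E => t • q) (t • ContinuousLinearMap.id ℝ E) q :=
        (hasFDerivAt_id q).const_smul t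
      have h2 := ((hf1 (t • q)).hasFDerivAt.comp q h1).const_smul (w t)
      exact h2.congr_fderiv (by ext v; simp [mul_smul])

/-- Cutoff: a function that is `C^n` at `0` agrees near `0` with a global `C^n` function. -/
theorem exists_cutoff {F : Type} [NormedAddCommGroup F] [NormedSpace ℝ F] {n : ℕ} {f : E → F}
    (hf : ContDiffAt ℝ n f 0) : ∃ g : E → F, ContDiff ℝ n g ∧ f =ᶠ[𝓝 0] g := by
  have h1 : ∀ᶠ x in 𝓝 (0:E), ContDiffAt ℝ n f x := hf.eventually (by simp)
  obtain ⟨r, hr, hball⟩ := Metric.eventually_nhds_iff_ball.1 h1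
  let χ : ContDiffBump (0:E) := ⟨r / 4, r / 2, by positivity, by linarith⟩
  refine ⟨fun x => χ x • f x, ?_, ?_⟩
  · refine contDiff_iff_contDiffAt.2 fun x => ?_
    by_cases hx : x ∈ Metric.ball (0:E) r
    · exact χ.contDiff.contDiffAt.smul (hball x hx)
    · have : (fun x => χ x • f x) =ᶠ[𝓝 x] fun _ => 0 := by
        have hx' : x ∉ tsupport χ := by
          rw [χ.tsupport_eq]
          simp only [Metric.mem_closedBall, Metric.mem_ball, χ] at hx ⊢
          linarith
        filter_upwards [notMem_tsupport_iff_eventuallyEq.1 hx'] with y hy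
        simp [hy]
      exact contDiffAt_const.congr_of_eventuallyEq this
  · filter_upwards [χ.eventuallyEq_one] with x hx
    simp [hx]

theorem eventually_ray {E : Type} [NormedAddCommGroup E] [NormedSpace ℝ E] {p : E → Prop} (h : ∀ᶠ x in 𝓝 (0:E), p x) :
    ∀ᶠ q in 𝓝 (0:E), ∀ t ∈ Set.Icc (0:ℝ) 1, p (t • q) := by
  obtain ⟨r, hr, hball⟩ := Metric.eventually_nhds_iff_ball.1 h
  filter_upwards [Metric.ball_mem_nhds (0:E) hr] with q hq t ht
  refine hball _ ?_
  rw [mem_ball_zero_iff] at hq ⊢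
  rw [norm_smul, Real.norm_eq_abs, abs_of_nonneg ht.1]
  nlinarith [ht.1, ht.2, norm_nonneg q]

theorem contDiffAt_avg {F : Type} [NormedAddCommGroup F] [NormedSpace ℝ F]
    {f : E → F} (hf : ContDiffAt ℝ (⊤ : ℕ∞) f 0) {w : ℝ → ℝ} (hw : Continuous w) :
    ContDiffAt ℝ (⊤ : ℕ∞) (fun q => ∫ t in (0:ℝ)..1, w t • f (t • q)) 0 := by
  refine contDiffAt_infty.2 fun n => ?_
  obtain ⟨g, hg, hfg⟩ := exists_cutoff (contDiffAt_infty.1 hf n)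
  refine (contDiff_avg n g hg w hw).contDiffAt.congr_of_eventuallyEq ?_
  filter_upwards [eventually_ray hfg] with q hq
  refine intervalIntegral.integral_congr fun t ht => ?_
  rw [Set.uIcc_of_le zero_le_one] at ht
  simp [hq t ht]

/-- The complex coordinate on the plane. -/
noncomputable def zc (q : ℝ × ℝ) : ℂ := (q.1 : ℂ) + q.2 * Complex.I

theorem zc_eq (q : ℝ × ℝ) : zc q = Complex.equivRealProdCLM.symm q := by
  simp [zc, Complex.equivRealProdCLM_symm_apply]

theorem contDiff_zc {n : WithTop ℕ∞} : ContDiff ℝ n zc := by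
  rw [show zc = _ from funext zc_eq]
  exact Complex.equivRealProdCLM.symm.contDiff

theorem zc_smul (t : ℝ) (q : ℝ × ℝ) : zc (t • q) = t * zc q := by
  simp [zc]; ring

theorem zc_zero : zc 0 = 0 := by simp [zc]

/-- Averaging along rays preserves the order. -/
theorem HasOrd.avg {N : ℕ} {F : ℝ × ℝ → ℂ} (hF : HasOrd zc 0 N F) :
    ∃ G, HasOrd zc 0 N G ∧ (fun q => ∫ t in (0:ℝ)..1, F (t • q)) =ᶠ[𝓝 0] G := by
  obtain ⟨g, hg, hF⟩ := hF
  refine ⟨fun q => ∑ i ∈ Finset.range (N + 1), zc q ^ i * (starRingEnd ℂ (zc q)) ^ (N - i) *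
    ∫ t in (0:ℝ)..1, t ^ N • g i (t • q),
    ⟨fun i q => ∫ t in (0:ℝ)..1, t ^ N • g i (t • q),
      fun i => contDiffAt_avg (hg i) (by fun_prop), fun x => rfl⟩, ?_⟩
  have hc : ∀ᶠ x in 𝓝 (0 : ℝ × ℝ), ∀ i ∈ Finset.range (N + 1), ContinuousAt (g i) x := by
    rw [Filter.eventually_all_finset]
    intro i _
    have := ((hg i).of_le (m := 1) (by exact_mod_cast le_top)).eventually (by simp)
    exact this.mono fun x hx => hx.continuousAt
  filter_upwards [eventually_ray hc] with q hq
  have h1 : ∀ t : ℝ, F (t • q) = ∑ i ∈ Finset.range (N + 1),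
      (zc q ^ i * (starRingEnd ℂ (zc q)) ^ (N - i)) * (t ^ N • g i (t • q)) := by
    intro t
    rw [hF]
    refine Finset.sum_congr rfl fun i hi => ?_
    have := Finset.mem_range.1 hi
    have h2 : ((t:ℂ)) ^ N = (t:ℂ) ^ i * (t:ℂ) ^ (N - i) := by
      rw [← pow_add]; congr 1; omega
    simp only [zc_smul, map_mul, Complex.conj_ofReal, mul_pow, Complex.real_smul]
    push_cast
    rw [h2]; ring
  simp only [h1]
  rw [intervalIntegral.integral_finsetSum]
  · simp only [intervalIntegral.integral_const_mul]
  · intro i hi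
    refine ContinuousOn.intervalIntegrable ?_
    rw [Set.uIcc_of_le zero_le_one]
    have hp : ContinuousOn (fun t : ℝ => t ^ N) (Set.Icc 0 1) := by fun_prop
    refine continuousOn_const.mul (hp.smul ?_)
    intro t ht
    exact ((hq t ht i hi).comp (f := fun t : ℝ => t • q)
      (by fun_prop)).continuousWithinAt

theorem hasOrd_fst : HasOrd zc 0 1 (fun q => (q.1 : ℂ)) := by
  have hz := (contDiff_zc (n := (⊤ : ℕ∞))).contDiffAt (x := 0)
  have := HasOrd.smul hz (F := fun _ => (1/2 : ℂ)) contDiffAt_const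
    ((hasOrd_z hz).add (hasOrd_conj hz))
  convert this using 2 with q
  simp [zc]
  ring

theorem hasOrd_snd : HasOrd zc 0 1 (fun q => (q.2 : ℂ)) := by
  have hz := (contDiff_zc (n := (⊤ : ℕ∞))).contDiffAt (x := 0)
  have := (HasOrd.smul hz (F := fun _ => (-Complex.I / 2 : ℂ)) contDiffAt_const
    (hasOrd_z hz)).add (HasOrd.smul hz (F := fun _ => (Complex.I / 2 : ℂ)) contDiffAt_const
    (hasOrd_conj hz))
  convert this using 2 with q
  simp [zc]
  linear_combination (q.2 : ℂ) * Complex.I_sq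

/-- Hadamard's lemma. -/
theorem hasOrd_of_vanish (n : ℕ) : ∀ (f : ℝ × ℝ → ℂ), ContDiffAt ℝ (⊤ : ℕ∞) f 0 →
    (∀ j, j < n → iteratedFDeriv ℝ j f 0 = 0) → ∃ F, HasOrd zc 0 n F ∧ f =ᶠ[𝓝 0] F := by
  have hz := (contDiff_zc (n := (⊤ : ℕ∞))).contDiffAt (x := 0)
  induction n with
  | zero => exact fun f hf _ => ⟨f, hasOrd_zero hf, EventuallyEq.rfl⟩
  | succ n ih =>
    intro f hf h0
    have hf' : ContDiffAt ℝ (⊤ : ℕ∞) (fderiv ℝ f) 0 := hf.fderiv_right (by simp)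
    have key : ∀ v : ℝ × ℝ, ∃ G, HasOrd zc 0 n G ∧
        (fun q => ∫ t in (0:ℝ)..1, fderiv ℝ f (t • q) v) =ᶠ[𝓝 0] G := by
      intro v
      obtain ⟨F, hF, hfF⟩ := ih (fun q => fderiv ℝ f q v) (hf'.clm_apply contDiffAt_const) (by
        intro j hj
        have h1 : iteratedFDeriv ℝ j (fderiv ℝ f) 0 = 0 := by
          rw [← norm_eq_zero, norm_iteratedFDeriv_fderiv, h0 _ (by omega), norm_zero]
        have := (ContinuousLinearMap.apply ℝ ℂ v).iteratedFDeriv_comp_left hf' (i := j)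
          (by exact_mod_cast le_top)
        rw [show (fun q => fderiv ℝ f q v) =
          (ContinuousLinearMap.apply ℝ ℂ v) ∘ (fderiv ℝ f) from rfl, this, h1]
        ext; simp)
      obtain ⟨G, hG, hFG⟩ := hF.avg
      refine ⟨G, hG, EventuallyEq.trans ?_ hFG⟩
      filter_upwards [eventually_ray hfF] with q hq
      refine intervalIntegral.integral_congr fun t ht => ?_
      rw [Set.uIcc_of_le zero_le_one] at ht
      exact hq t ht
    obtain ⟨G1, hG1, e1⟩ := key (1, 0)
    obtain ⟨G2, hG2, e2⟩ := key (0, 1)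
    refine ⟨fun q => (q.1 : ℂ) * G1 q + (q.2 : ℂ) * G2 q, ?_, ?_⟩
    · rw [add_comm n 1]
      exact (hasOrd_fst.mul hz hG1).add (hasOrd_snd.mul hz hG2)
    · have hd : ∀ᶠ x in 𝓝 (0 : ℝ × ℝ), ContDiffAt ℝ 1 f x :=
        (hf.of_le (m := 1) (by exact_mod_cast le_top)).eventually (by simp)
      have f0 : f 0 = 0 := by
        have := congrArg (fun g => g 0) (h0 0 (by omega))
        simpa using this
      filter_upwards [eventually_ray hd, e1, e2] with q hq h1 h2
      rw [← h1, ← h2]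
      have hcont : ∀ v : ℝ × ℝ, IntervalIntegrable (fun t : ℝ => fderiv ℝ f (t • q) v)
          MeasureTheory.volume 0 1 := by
        intro v
        refine ContinuousOn.intervalIntegrable ?_
        rw [Set.uIcc_of_le zero_le_one]
        intro t ht
        have hc : ContinuousAt (fderiv ℝ f) (t • q) :=
          ((hq t ht).fderiv_right (m := 0) (by simp)).continuousAt
        exact ((hc.comp (f := fun t : ℝ => t • q)
          (by fun_prop)).clm_apply continuousAt_const).continuousWithinAt
      have hint := intervalIntegral.integral_eq_sub_of_hasDerivAt
        (f := fun t : ℝ => f (t • q)) (f' := fun t => fderiv ℝ f (t • q) q) (a := 0) (b := 1)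
        (fun t ht => by
          rw [Set.uIcc_of_le zero_le_one] at ht
          have hh : HasDerivAt (fun t : ℝ => t • q) q t := by
            simpa using (hasDerivAt_id t).smul_const q
          exact ((hq t ht).differentiableAt (by simp)).hasFDerivAt.comp_hasDerivAt t hh) (hcont q)
      simp only [one_smul, zero_smul, f0, sub_zero] at hint
      rw [← hint]
      have hsplit : ∀ t : ℝ, fderiv ℝ f (t • q) q =
          (q.1 : ℂ) * fderiv ℝ f (t • q) (1, 0) + (q.2 : ℂ) * fderiv ℝ f (t • q) (0, 1) := by
        intro t
        have : q = q.1 • ((1:ℝ), (0:ℝ)) + q.2 • ((0:ℝ), (1:ℝ)) := by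
          ext <;> simp
        conv_lhs => rw [show fderiv ℝ f (t • q) q = fderiv ℝ f (t • q)
          (q.1 • ((1:ℝ), (0:ℝ)) + q.2 • ((0:ℝ), (1:ℝ))) from congrArg _ this]
        rw [map_add, map_smul, map_smul, Complex.real_smul, Complex.real_smul]
      simp only [hsplit]
      rw [intervalIntegral.integral_add ((hcont _).const_mul _) ((hcont _).const_mul _),
        intervalIntegral.integral_const_mul, intervalIntegral.integral_const_mul]

end Hadamard

section Poly

theorem pderiv_comm_aux {R : Type*} [CommSemiring R] (p : MvPolynomial (Fin 2) R) :
    pderiv 0 (pderiv 1 p) = pderiv 1 (pderiv 0 p) := by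
  ext m
  simp only [coeff_pderiv, Finsupp.add_apply]
  rw [add_right_comm]
  simp
  ring

/-- The expression of a real polynomial in the variables `z, conj z`. -/
noncomputable def cpx : MvPolynomial (Fin 2) ℝ →ₐ[ℝ] MvPolynomial (Fin 2) ℂ :=
  aeval ![C (1 / 2) * (X 0 + X 1), C (-Complex.I / 2) * (X 0 - X 1)]

theorem pderiv_cpx_zero (p : MvPolynomial (Fin 2) ℝ) :
    pderiv 0 (cpx p) = C (1 / 2) * cpx (pderiv 0 p) + C (-Complex.I / 2) * cpx (pderiv 1 p) := by
  induction p using MvPolynomial.induction_on with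
  | C a =>
    have : cpx (C a) = C (a : ℂ) := by simp [cpx, MvPolynomial.algebraMap_apply]
    simp [this]
  | add p q hp hq => simp only [map_add, hp, hq]; ring
  | mul_X p i hp =>
    rw [map_mul, pderiv_mul, hp, pderiv_mul, pderiv_mul]
    simp only [map_add, map_mul]
    fin_cases i
    · simp [cpx, pderiv_X]; ring
    · simp [cpx, pderiv_X]; ring

theorem pderiv_cpx_one (p : MvPolynomial (Fin 2) ℝ) :
    pderiv 1 (cpx p) = C (1 / 2) * cpx (pderiv 0 p) + C (Complex.I / 2) * cpx (pderiv 1 p) := by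
  induction p using MvPolynomial.induction_on with
  | C a =>
    have : cpx (C a) = C (a : ℂ) := by simp [cpx, MvPolynomial.algebraMap_apply]
    simp [this]
  | add p q hp hq => simp only [map_add, hp, hq]; ring
  | mul_X p i hp =>
    rw [map_mul, pderiv_mul, hp, pderiv_mul, pderiv_mul]
    simp only [map_add, map_mul]
    fin_cases i
    · simp [cpx, pderiv_X]; ring
    · simp [cpx, pderiv_X, neg_div]; ring

theorem cpx_pLap (p : MvPolynomial (Fin 2) ℝ) :
    pderiv 0 (pderiv 1 (cpx p)) = C (1 / 4) * cpx (pLap p) := by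
  rw [pderiv_cpx_one, map_add, pderiv_C_mul, pderiv_C_mul, pderiv_cpx_zero, pderiv_cpx_zero, pLap,
    pderiv_comm_aux, map_add]
  have h1 : (C (1 / 4) : MvPolynomial (Fin 2) ℂ) = C (1 / 2) * C (1 / 2) := by
    rw [← C_mul]; norm_num
  have h2 : (C (1 / 2) * C (1 / 2) : MvPolynomial (Fin 2) ℂ) =
      C (Complex.I / 2) * C (-Complex.I / 2) := by
    rw [← C_mul, ← C_mul]; congr 1; ring_nf; simp; norm_num
  have h3 : (C (-Complex.I / 2) : MvPolynomial (Fin 2) ℂ) = - C (Complex.I / 2) := by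
    rw [← C_neg]; congr 1; ring
  rw [mul_add, mul_add, mul_add, ← mul_assoc (C (Complex.I / 2)) (C (-Complex.I / 2)), ← h2, h1, h3]
  ring

theorem iter_cpx (n : ℕ) : ∀ (p : MvPolynomial (Fin 2) ℝ), pLap^[n] p = 0 →
    (fun Q => pderiv 0 (pderiv 1 Q))^[n] (cpx p) = 0 := by
  have key : ∀ (n : ℕ) (a : ℂ) (Q : MvPolynomial (Fin 2) ℂ),
      (fun Q => pderiv 0 (pderiv 1 Q))^[n] (C a * Q) =
      C a * (fun Q => pderiv 0 (pderiv 1 Q))^[n] Q := by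
    intro n a
    induction n with
    | zero => simp
    | succ n ih =>
      intro Q
      rw [Function.iterate_succ_apply, Function.iterate_succ_apply, ← ih]
      simp
  induction n with
  | zero => intro p hp; simp at hp; simp [hp]
  | succ n ih =>
    intro p hp
    rw [Function.iterate_succ_apply] at hp ⊢
    rw [cpx_pLap, key, ih _ hp, mul_zero]

theorem coeff_iter (n : ℕ) : ∀ (Q : MvPolynomial (Fin 2) ℂ) (m : Fin 2 →₀ ℕ),
    (fun Q => pderiv 0 (pderiv 1 Q))^[n] Q = 0 →
    coeff (m + Finsupp.single 0 n + Finsupp.single 1 n) Q = 0 := by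
  induction n with
  | zero => intro Q m h; simp at h; simp [h]
  | succ n ih =>
    intro Q m h
    rw [Function.iterate_succ_apply] at h
    have := ih _ m h
    rw [coeff_pderiv, coeff_pderiv] at this
    have h2 : (m + Finsupp.single 0 (n + 1) + Finsupp.single 1 (n + 1) : Fin 2 →₀ ℕ) =
      m + Finsupp.single 0 n + Finsupp.single 1 n + Finsupp.single 0 1 + Finsupp.single 1 1 := by
      rw [Finsupp.single_add, Finsupp.single_add]; abel
    rw [h2]
    rcases mul_eq_zero.1 this with h3 | h3
    · rcases mul_eq_zero.1 h3 with h4 | h4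
      · exact h4
      · exfalso; norm_cast at h4
    · exfalso; norm_cast at h3

theorem eval_cpx (p : MvPolynomial (Fin 2) ℝ) (q : ℝ × ℝ) :
    eval ![zc q, starRingEnd ℂ (zc q)] (cpx p) = (toFun2 p q : ℂ) := by
  unfold toFun2
  induction p using MvPolynomial.induction_on with
  | C a =>
    have : cpx (C a) = C (a : ℂ) := by simp [cpx, MvPolynomial.algebraMap_apply]
    simp [this]
  | add p q hp hq => simp only [map_add, hp, hq]; push_cast; rfl
  | mul_X p i hp =>
    rw [map_mul, map_mul, hp, map_mul]
    push_cast
    congr 1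
    fin_cases i
    · simp [cpx, zc]; ring
    · simp [cpx, zc]; linear_combination -(q.2 : ℂ) * Complex.I_sq

theorem eval_hom (Q : MvPolynomial (Fin 2) ℂ) (n : ℕ) (hQ : Q.IsHomogeneous n) (x y : ℂ) :
    eval ![x, y] Q = ∑ i ∈ Finset.range (n + 1), x ^ i * y ^ (n - i) *
      coeff (Finsupp.single 0 i + Finsupp.single 1 (n - i)) Q := by
  rw [eval_eq']
  have hd : ∀ d ∈ Q.support, d 0 + d 1 = n := by
    intro d hd
    have := hQ.degree_eq_sum_deg_support hd
    rw [this]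
    change _ = d.degree
    rw [Finsupp.degree_eq_sum]
    simp
  have hrec : ∀ d ∈ Q.support, Finsupp.single 0 (d 0) + Finsupp.single 1 (n - d 0) = d := by
    intro d hd'
    have := hd d hd'
    ext i
    fin_cases i
    · simp
    · simp; omega
  refine Finset.sum_of_injOn (fun d => d 0) ?_ ?_ ?_ ?_
  · intro a ha b hb hab
    rw [← hrec a ha, ← hrec b hb]
    simp only at hab
    rw [hab]
  · intro d hd'
    have := hd d hd'
    simp; omega
  · intro i hi hni
    have : coeff (Finsupp.single 0 i + Finsupp.single 1 (n - i)) Q = 0 := by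
      by_contra hne
      exact hni ⟨_, mem_support_iff.2 hne, by simp⟩
    rw [this, mul_zero]
  · intro d hd'
    rw [hrec d hd']
    have := hd d hd'
    simp only [Fin.prod_univ_two, Matrix.cons_val_zero, Matrix.cons_val_one]
    rw [show n - d 0 = d 1 by omega]
    ring

theorem poly_repr (m l : ℕ) (p : MvPolynomial (Fin 2) ℝ) (hp : p.IsHomogeneous (m + l))
    (hlap : pLap^[l + 1] p = 0) :
    ∃ a : ℕ → ℂ, (∀ i, i < m → l < i → a i = 0) ∧ ∀ q, toFun2 p q =
      (∑ i ∈ Finset.range (m + l + 1),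
        zc q ^ i * (starRingEnd ℂ (zc q)) ^ (m + l - i) * a i).re := by
  refine ⟨fun i => coeff (Finsupp.single 0 i + Finsupp.single 1 (m + l - i)) (cpx p), ?_, ?_⟩
  · intro i h1 h2
    have := coeff_iter (l + 1) (cpx p)
      (Finsupp.single 0 (i - (l + 1)) + Finsupp.single 1 (m - 1 - i)) (iter_cpx _ _ hlap)
    convert this using 2
    ext j
    fin_cases j
    · simp; omega
    · simp; omega
  · intro q
    have hh : (cpx p).IsHomogeneous (m + l) := by
      have := hp.aeval (S := ℂ) (τ := Fin 2) (n := 1)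
        ![C (1 / 2) * (X 0 + X 1), C (-Complex.I / 2) * (X 0 - X 1)] (by
        intro i
        fin_cases i
        · exact ((isHomogeneous_X _ _).add (isHomogeneous_X _ _)).C_mul _
        · exact ((isHomogeneous_X _ _).sub (isHomogeneous_X _ _)).C_mul _)
      rw [one_mul] at this
      unfold cpx
      exact this
    rw [← eval_hom _ _ hh, eval_cpx, Complex.ofReal_re]

/-- Polynomials killed by `Δ^(l+1)`, as real parts. -/
theorem poly_factor (m l : ℕ) (p : MvPolynomial (Fin 2) ℝ) (hp : p.IsHomogeneous (m + l))
    (hlap : pLap^[l + 1] p = 0) :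
    ∃ G, HasOrd zc 0 l G ∧ ∀ q, toFun2 p q = (zc q ^ m * G q).re := by
  obtain ⟨a, ha, h⟩ := poly_repr m l p hp hlap
  obtain ⟨G, hG, h'⟩ := re_factor (z := zc) (x0 := 0) contDiff_zc.contDiffAt m l
    (fun i _ => a i) (fun i => contDiffAt_const) (fun i h1 h2 _ => ha i h1 h2)
  exact ⟨G, hG, fun q => by rw [h, h']⟩

theorem harmonic_repr (k : ℕ) (hk : 0 < k) (p : MvPolynomial (Fin 2) ℝ) (hp : p.IsHomogeneous k)
    (hne : p ≠ 0) (hlap : pLap p = 0) :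
    ∃ c : ℂ, c ≠ 0 ∧ ∀ q, toFun2 p q = (c * zc q ^ k).re := by
  obtain ⟨a, ha, h⟩ := poly_repr k 0 p hp (by simpa using hlap)
  have hh : ∀ q, toFun2 p q = ((a k + starRingEnd ℂ (a 0)) * zc q ^ k).re := by
    intro q
    rw [h, Finset.sum_range_succ, Finset.sum_range, Finset.sum_eq_single ⟨0, by omega⟩]
    · have : ∀ w : ℂ, (starRingEnd ℂ w).re = w.re := Complex.conj_re
      rw [Complex.add_re, ← this (zc q ^ _ * _ * a _)]
      rw [← Complex.add_re]
      congr 1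
      simp
      ring
    · intro i _ hi
      have : a i = 0 := ha i (by simpa using i.2) (by
        rcases Nat.eq_zero_or_pos i.1 with h | h
        · exact absurd (Fin.ext h) hi
        · exact h)
      rw [this, mul_zero]
    · simp
  refine ⟨_, fun h0 => hne ?_, hh⟩
  refine MvPolynomial.funext fun x => ?_
  have := hh (x 0, x 1)
  rw [h0] at this
  simp only [toFun2, zero_mul, Complex.zero_re] at this
  rw [map_zero, ← this]
  congr 2
  ext i
  fin_cases i <;> rfl

end Poly

section Main

theorem hasFDerivAt_mul_zero {a b : ℝ × ℝ → ℂ} (ha : DifferentiableAt ℝ a 0)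
    (hb : DifferentiableAt ℝ b 0) (ha0 : a 0 = 0) (hb0 : b 0 = 0) :
    HasFDerivAt (fun x => a x * b x) (0 : ℝ × ℝ →L[ℝ] ℂ) 0 := by
  have := ha.hasFDerivAt.mul hb.hasFDerivAt
  exact this.congr_fderiv (by rw [ha0, hb0]; ext <;> simp)

theorem HasOrd.hasFDerivAt {F : ℝ × ℝ → ℂ} (hF : HasOrd zc 0 2 F) :
    HasFDerivAt F (0 : ℝ × ℝ →L[ℝ] ℂ) 0 := by
  have hz := (contDiff_zc (n := (⊤ : ℕ∞))).contDiffAt (x := 0)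
  have hne : ((⊤ : ℕ∞) : WithTop ℕ∞) ≠ 0 := by simp
  obtain ⟨g, hg, hF⟩ := hF.split hz
  have h1 := hasFDerivAt_mul_zero ((smooth_conj hz).differentiableAt hne)
    (((hg 0).smooth hz).differentiableAt hne) (by simp [zc_zero])
    ((hg 0).eq_zero one_ne_zero zc_zero)
  have h2 := hasFDerivAt_mul_zero (hz.differentiableAt hne)
    (((hg 1).smooth hz).differentiableAt hne) zc_zero
    ((hg 1).eq_zero one_ne_zero zc_zero)
  rw [show F = _ from funext hF]
  have := h1.add h2
  rw [add_zero] at this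
  refine this.congr_of_eventuallyEq (Eventually.of_forall fun x => ?_)
  simp [Finset.sum_range_succ]

theorem main_analytic (n d : ℕ) (hd : 2 ≤ d) (hnd : n + 1 ≤ 2 * d) (c : ℂ) (hc : c ≠ 0)
    (u : ℝ × ℝ → ℂ) (hu : ContDiffAt ℝ (⊤ : ℕ∞) u 0) (hu0 : u 0 = 0)
    (q : ℝ × ℝ → ℂ) (hq : HasOrd zc 0 d q) :
    ∃ w : ℝ × ℝ → ℂ, ContDiffAt ℝ (⊤ : ℕ∞) w 0 ∧ w 0 = 0 ∧
      HasFDerivAt w (Complex.equivRealProdCLM.symm : ℝ × ℝ →L[ℝ] ℂ) 0 ∧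
      ∀ᶠ x in 𝓝 0, (c * w x ^ (n + 2)).re =
        (c * zc x ^ (n + 2) * (1 + u x) + zc x ^ (n + 1) * q x).re := by
  have hz := (contDiff_zc (n := (⊤ : ℕ∞))).contDiffAt (x := 0)
  have hne : ((⊤ : ℕ∞) : WithTop ℕ∞) ≠ 0 := by simp
  have hck : c * (n + 2) ≠ 0 := mul_ne_zero hc (by exact_mod_cast (by omega : n + 2 ≠ 0))
  -- the root
  obtain ⟨v, hv, hv0, hvk⟩ : ∃ v : ℝ × ℝ → ℂ, ContDiffAt ℝ (⊤ : ℕ∞) v 0 ∧ v 0 = 1 ∧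
      ∀ x, v x ^ (n + 2) = 1 + u x := by
    refine ⟨fun x => (1 + u x) ^ (((n + 2 : ℕ) : ℂ)⁻¹), ?_, by simp [hu0], fun x =>
      Complex.cpow_nat_inv_pow _ (by omega)⟩
    have h1 : ContDiffAt ℝ (⊤ : ℕ∞) (fun y : ℂ => y ^ (((n + 2 : ℕ) : ℂ)⁻¹)) (1 + u 0) := by
      have : AnalyticAt ℂ (fun y : ℂ => y ^ (((n + 2 : ℕ) : ℂ)⁻¹)) (1 + u 0) :=
        analyticAt_id.cpow analyticAt_const (by simp [hu0])
      exact this.contDiffAt.restrict_scalars ℝ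
    exact h1.comp (0 : ℝ × ℝ) (contDiffAt_const.add hu)
  obtain ⟨r, hr, hqr⟩ := hq
  let t0 : Fin (d + 1) → ℂ := fun i => r i 0 / (c * (n + 2))
  let x0 : (ℝ × ℝ) × (Fin (d + 1) → ℂ) := (0, t0)
  let Z : (ℝ × ℝ) × (Fin (d + 1) → ℂ) → ℂ := fun p => zc p.1
  have hZ : ContDiffAt ℝ (⊤ : ℕ∞) Z x0 := (contDiff_zc.comp contDiff_fst).contDiffAt
  have hV : ContDiffAt ℝ (⊤ : ℕ∞) (fun p : (ℝ × ℝ) × (Fin (d + 1) → ℂ) => v p.1) x0 :=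
    ContDiffAt.comp x0 (by exact hv) contDiffAt_fst
  have ht : ∀ i, ContDiffAt ℝ (⊤ : ℕ∞) (fun p : (ℝ × ℝ) × (Fin (d + 1) → ℂ) => p.2 i) x0 := by
    intro i
    fun_prop
  have hrX : ∀ i, ContDiffAt ℝ (⊤ : ℕ∞) (fun p : (ℝ × ℝ) × (Fin (d + 1) → ℂ) => r i p.1) x0 :=
    fun i => ContDiffAt.comp x0 (by exact hr i) contDiffAt_fst
  let ξ : (ℝ × ℝ) × (Fin (d + 1) → ℂ) → ℂ := fun p => ∑ i : Fin (d + 1),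
    zc p.1 ^ (i : ℕ) * (starRingEnd ℂ (zc p.1)) ^ (d - i) * p.2 i
  have hξ : HasOrd Z x0 d ξ := HasOrd.sum _ fun i _ => hasOrd_mono (z := Z) hZ (by omega) (ht i)
  let Rem : (ℝ × ℝ) × (Fin (d + 1) → ℂ) → ℂ := fun p => ∑ j ∈ Finset.range (n + 1),
    (c * (n + 2).choose (j + 2)) * (ξ p ^ (j + 2) * (v p.1 * Z p) ^ (n - j))
  have hRem : HasOrd Z x0 (n + 1 + (2 * d - 1)) Rem := by
    refine HasOrd.sum _ fun j hj => HasOrd.smul hZ contDiffAt_const ?_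
    have h1 := (hξ.pow hZ (j + 2)).mul hZ ((HasOrd.smul hZ hV (hasOrd_z hZ)).pow hZ (n - j))
    refine h1.mono hZ ?_
    have := Finset.mem_range.1 hj
    have h2 : j * 1 ≤ j * d := Nat.mul_le_mul_left _ (by omega)
    rw [add_mul]
    omega
  have hbin : ∀ p, c * (v p.1 * Z p + ξ p) ^ (n + 2) = c * Z p ^ (n + 2) * (1 + u p.1) +
      Z p ^ (n + 1) * (c * (n + 2) * v p.1 ^ (n + 1) * ξ p) + Rem p := by
    intro p
    rw [add_comm (v p.1 * Z p), add_pow, Finset.sum_range_succ', Finset.sum_range_succ', ← hvk,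
      mul_add, mul_add, Finset.mul_sum]
    have : ∑ i ∈ Finset.range (n + 1), c * (ξ p ^ (i + 1 + 1) * (v p.1 * Z p) ^
        (n + 2 - (i + 1 + 1)) * ((n + 2).choose (i + 1 + 1) : ℕ)) = Rem p := by
      refine Finset.sum_congr rfl fun j _ => ?_
      rw [show n + 2 - (j + 1 + 1) = n - j by omega]
      ring
    rw [this]
    simp
    ring
  obtain ⟨G, hG, hGre⟩ := hRem.re_factor hZ (by omega)
  obtain ⟨g, hg, hgG⟩ := (hG.mono hZ (show d + 1 ≤ 2 * d - 1 by omega)).split hZ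
  let Φ : (ℝ × ℝ) × (Fin (d + 1) → ℂ) → (Fin (d + 1) → ℂ) := fun p i =>
    c * (n + 2) * v p.1 ^ (n + 1) * p.2 i - r i p.1 + g i p
  have hΦ : ContDiffAt ℝ (⊤ : ℕ∞) Φ x0 := by
    refine contDiffAt_pi.2 fun i => ?_
    exact (((contDiffAt_const.mul (hV.pow (n + 1))).mul (ht i)).sub (hrX i)).add ((hg i).smooth hZ)
  have hΦ0 : ∀ t, Φ (0, t) = fun i => c * (n + 2) * t i - r i 0 := by
    intro t
    funext i
    have : g i ((0 : ℝ × ℝ), t) = 0 := (hg i).eq_zero one_ne_zero zc_zero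
    simp [Φ, this, hv0]
  have hder : fderiv ℝ Φ x0 ∘L .inr ℝ (ℝ × ℝ) (Fin (d + 1) → ℂ) =
      (c * (n + 2)) • ContinuousLinearMap.id ℝ (Fin (d + 1) → ℂ) := by
    have h1 : HasFDerivAt (fun t => Φ (0, t))
        (fderiv ℝ Φ x0 ∘L .inr ℝ (ℝ × ℝ) (Fin (d + 1) → ℂ)) t0 :=
      (hΦ.differentiableAt hne).hasFDerivAt.comp t0 (hasFDerivAt_prodMk_right (0 : ℝ × ℝ) t0)
    have h2 : HasFDerivAt (fun t => Φ (0, t))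
        ((c * (n + 2)) • ContinuousLinearMap.id ℝ (Fin (d + 1) → ℂ)) t0 := by
      have h3 := ((hasFDerivAt_id (𝕜 := ℝ) t0).const_smul (c * ((n : ℂ) + 2))).sub_const
        (fun i : Fin (d + 1) => r i 0)
      refine h3.congr_of_eventuallyEq (Eventually.of_forall fun t => ?_)
      beta_reduce
      rw [hΦ0]
      rfl
    exact h1.unique h2
  have hinv : (fderiv ℝ Φ x0 ∘L .inr ℝ (ℝ × ℝ) (Fin (d + 1) → ℂ)).IsInvertible := by
    rw [hder]
    refine ContinuousLinearMap.IsInvertible.of_inverse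
      (g := (c * (n + 2))⁻¹ • ContinuousLinearMap.id ℝ (Fin (d + 1) → ℂ)) ?_ ?_
    · ext t i
      simp only [ContinuousLinearMap.comp_apply, _root_.smul_apply,
        ContinuousLinearMap.id_apply, smul_smul, mul_inv_cancel₀ hck, one_smul]
    · ext t i
      simp only [ContinuousLinearMap.comp_apply, _root_.smul_apply,
        ContinuousLinearMap.id_apply, smul_smul, inv_mul_cancel₀ hck, one_smul]
  let τ := hΦ.implicitFunction hne hinv
  have hτ : ContDiffAt ℝ (⊤ : ℕ∞) τ 0 := hΦ.contDiffAt_implicitFunction hne hinv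
  have hτe : ∀ᶠ x in 𝓝 (0 : ℝ × ℝ), Φ (x, τ x) = 0 := by
    have h1 := hΦ.eventually_apply_implicitFunction hne hinv
    have h2 : Φ x0 = 0 := by
      rw [hΦ0]
      funext i
      simp only [t0, Pi.zero_apply]
      rw [mul_div_cancel₀ _ hck, sub_self]
    rw [h2] at h1
    exact h1
  have hξ' : HasOrd zc 0 d (fun x => ξ (x, τ x)) :=
    HasOrd.sum _ fun i _ => hasOrd_mono hz (by omega) (contDiffAt_pi.1 hτ i)
  refine ⟨fun x => v x * zc x + ξ (x, τ x), (hv.mul hz).add (hξ'.smooth hz), ?_, ?_, ?_⟩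
  · beta_reduce
    rw [zc_zero, mul_zero, zero_add]
    exact hξ'.eq_zero (by omega) zc_zero
  · have h1 := (hξ'.mono hz hd).hasFDerivAt
    have h2 := hasFDerivAt_mul_zero (a := fun x => v x - 1)
      ((hv.differentiableAt hne).sub_const 1) (hz.differentiableAt hne) (by simp [hv0]) zc_zero
    have h3 : HasFDerivAt zc (Complex.equivRealProdCLM.symm : ℝ × ℝ →L[ℝ] ℂ) 0 := by
      rw [show zc = _ from funext zc_eq]
      exact Complex.equivRealProdCLM.symm.hasFDerivAt
    have h4 := (h3.add h2).add h1
    rw [add_zero, add_zero] at h4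
    refine h4.congr_of_eventuallyEq (Eventually.of_forall fun x => ?_)
    simp only [Pi.add_apply]
    ring
  · filter_upwards [hτe] with x hx
    rw [hbin (x, τ x), Complex.add_re, hGre, ← Complex.add_re]
    congr 1
    have hsum : c * (n + 2) * v x ^ (n + 1) * ξ (x, τ x) + G (x, τ x) = q x := by
      rw [hgG, hqr, Finset.sum_range, Finset.sum_range, Finset.mul_sum, ← Finset.sum_add_distrib]
      refine Finset.sum_congr rfl fun i _ => ?_
      have := congrFun hx i
      simp only [Φ, Pi.zero_apply] at this
      simp only [Z]
      linear_combination (zc x ^ (i : ℕ) * (starRingEnd ℂ (zc x)) ^ (d - i)) * this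
    rw [← hsum]
    simp only [Z]
    ring

theorem rightEquiv_of (h₁ h₂ : ℝ × ℝ → ℝ) (w : ℝ × ℝ → ℂ) (hw : ContDiffAt ℝ (⊤ : ℕ∞) w 0)
    (hw0 : w 0 = 0)
    (hwd : HasFDerivAt w (Complex.equivRealProdCLM.symm : ℝ × ℝ →L[ℝ] ℂ) 0)
    (he : ∀ᶠ x in 𝓝 0, h₁ (Complex.equivRealProdCLM (w x)) = h₂ x) : RightEquiv h₁ h₂ := by
  have hne : ((⊤ : ℕ∞) : WithTop ℕ∞) ≠ 0 := by simp
  let φ : ℝ × ℝ → ℝ × ℝ := fun x => Complex.equivRealProdCLM (w x)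
  have hφ : ContDiffAt ℝ (⊤ : ℕ∞) φ 0 :=
    Complex.equivRealProdCLM.contDiff.contDiffAt.comp (0 : ℝ × ℝ) hw
  have hφ0 : φ 0 = 0 := by simp [φ, hw0]
  have hφd : HasFDerivAt φ ((ContinuousLinearEquiv.refl ℝ (ℝ × ℝ) :
      (ℝ × ℝ) ≃L[ℝ] (ℝ × ℝ)) : ℝ × ℝ →L[ℝ] ℝ × ℝ) 0 := by
    have := Complex.equivRealProdCLM.hasFDerivAt.comp (0 : ℝ × ℝ) hwd
    refine this.congr_fderiv ?_
    ext <;> simp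
  have hs := hφ.hasStrictFDerivAt' hφd hne
  have hinv : ContDiffAt ℝ (⊤ : ℕ∞) (hφ.localInverse hφd hne) (φ 0) :=
    hφ.to_localInverse hφd hne
  refine ⟨φ, hφ.localInverse hφd hne, hφ, ?_, hφ0, ?_, ?_, ?_, he⟩
  · rwa [hφ0] at hinv
  · have := hφ.localInverse_apply_image hφd hne
    rwa [hφ0] at this
  · exact hs.eventually_left_inverse
  · have := hs.eventually_right_inverse
    rw [hφ0] at this
    exact this

end Main

/-- main theorem. Let `k ≥ 5`, `h` a nonzero homogeneous harmonic polynomial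
of degree `k`, for each `s ∈ {1,…,k-4}` let `ρ s` be homogeneous of degree `k+s` with
`Δ^{σ_s} (ρ s) = 0` where `σ_s = s+1` if `s < (k-3)/2` and `σ_s = s+2` otherwise, and let
`R ∈ m₂^{2k-3}`. Then `h` and `h + Σ ρ s + R` are right equivalent as germs at `0`. -/
theorem harmonic_leading_term_classification
    (k : ℕ) (hk : 5 ≤ k)
    (h : MvPolynomial (Fin 2) ℝ) (hne : h ≠ 0)
    (hhom : h.IsHomogeneous k) (hharm : pLap h = 0)
    (ρ : ℕ → MvPolynomial (Fin 2) ℝ)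
    (hρhom : ∀ s ∈ Finset.Icc 1 (k - 4), (ρ s).IsHomogeneous (k + s))
    (hρker : ∀ s ∈ Finset.Icc 1 (k - 4),
      pLap^[if 2 * s < k - 3 then s + 1 else s + 2] (ρ s) = 0)
    (R : ℝ × ℝ → ℝ) (hRs : ContDiffAt ℝ (⊤ : ℕ∞) R 0) (hRm : VanishTo (2 * k - 3) R) :
    RightEquiv (toFun2 h)
      (fun q => toFun2 h q + (∑ s ∈ Finset.Icc 1 (k - 4), toFun2 (ρ s) q) + R q) := by
  classical
  have hz := (contDiff_zc (n := (⊤ : ℕ∞))).contDiffAt (x := 0)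
  obtain ⟨n, rfl⟩ : ∃ n, k = n + 2 := ⟨k - 2, by omega⟩
  obtain ⟨c, hc, hh⟩ := harmonic_repr (n + 2) (by omega) h hhom hne hharm
  set d := (n + 2) / 2 with hd
  -- the jet terms
  have hterm : ∀ s : ℕ, ∃ U Q : ℝ × ℝ → ℂ, s ∈ Finset.Icc 1 (n + 2 - 4) →
      (HasOrd zc 0 1 U ∧ HasOrd zc 0 d Q ∧
      ∀ x, toFun2 (ρ s) x = (c * zc x ^ (n + 2) * U x + zc x ^ (n + 1) * Q x).re) := by
    intro s
    by_cases hs : s ∈ Finset.Icc 1 (n + 2 - 4)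
    swap
    · exact ⟨fun _ => 0, fun _ => 0, fun h => absurd h hs⟩
    have h1 := hρhom s hs
    have h2 := hρker s hs
    have hs' := Finset.mem_Icc.1 hs
    split_ifs at h2 with hlt
    · obtain ⟨G, hG, hGe⟩ := poly_factor (n + 2) s (ρ s) h1 h2
      refine ⟨fun x => c⁻¹ * G x, fun _ => 0, fun _ =>
        ⟨HasOrd.smul hz contDiffAt_const (hG.mono hz hs'.1), HasOrd.of_zero d, fun x => ?_⟩⟩
      rw [hGe]
      congr 1
      field_simp
      ring
    · obtain ⟨G, hG, hGe⟩ := poly_factor (n + 1) (s + 1) (ρ s)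
        (by rwa [show n + 1 + (s + 1) = n + 2 + s by omega]) h2
      refine ⟨fun _ => 0, G, fun _ => ⟨HasOrd.of_zero 1, hG.mono hz (by omega), fun x => ?_⟩⟩
      rw [hGe, mul_zero, zero_add]
  choose U Q hUQ using hterm
  -- the remainder
  obtain ⟨QR, hQR, hQRe⟩ : ∃ QR, HasOrd zc 0 d QR ∧
      ∀ᶠ x in 𝓝 0, R x = (zc x ^ (n + 1) * QR x).re := by
    have hRc : ContDiffAt ℝ (⊤ : ℕ∞) (fun x => (R x : ℂ)) 0 :=
      Complex.ofRealCLM.contDiff.contDiffAt.comp (0 : ℝ × ℝ) hRs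
    obtain ⟨F, hF, hRF⟩ := hasOrd_of_vanish (2 * (n + 2) - 3) (fun x => (R x : ℂ)) hRc (by
      intro j hj
      have := Complex.ofRealCLM.iteratedFDeriv_comp_left hRs (i := j) (by exact_mod_cast le_top)
      rw [show (fun x => (R x : ℂ)) = Complex.ofRealCLM ∘ R from rfl, this, hRm j hj]
      ext; simp)
    rw [show 2 * (n + 2) - 3 = (n + 1) + n by omega] at hF
    obtain ⟨G, hG, hGe⟩ := hF.re_factor hz (by omega)
    refine ⟨G, hG.mono hz (by omega), ?_⟩
    filter_upwards [hRF] with x hx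
    rw [← hGe, ← hx, Complex.ofReal_re]
  have hu := HasOrd.sum (Finset.Icc 1 (n + 2 - 4)) fun s hs => (hUQ s hs).1
  have hq := (HasOrd.sum (Finset.Icc 1 (n + 2 - 4)) fun s hs => (hUQ s hs).2.1).add hQR
  obtain ⟨w, hw, hw0, hwd, hwe⟩ := main_analytic n d (by omega) (by omega) c hc _ (hu.smooth hz)
    (hu.eq_zero one_ne_zero zc_zero) _ hq
  refine rightEquiv_of _ _ w hw hw0 hwd ?_
  filter_upwards [hwe, hQRe] with x hx hR
  have hzw : zc (Complex.equivRealProdCLM (w x)) = w x := by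
    rw [zc_eq, ContinuousLinearEquiv.symm_apply_apply]
  rw [hh, hzw, hx, hh, hR, Finset.sum_congr rfl fun s hs => (hUQ s hs).2.2 x, ← Complex.re_sum,
    ← Complex.add_re, ← Complex.add_re]
  congr 1
  rw [Finset.sum_add_distrib, ← Finset.mul_sum, ← Finset.mul_sum]
  ring
end

section
/- Let k ≥ 5 be a natural number, let h_k be a nonzero homogeneous harmonic polynomial of degree k in the two real variables x, y, and let R be a smooth function-germ at 0 ∈ ℝ² with R ∈ m₂^{k+1} (order of R greater than k) satisfying Δ²R = 0. Then the function-germs h_k and h_k + R are right equivalent. -/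
open MvPolynomial Filter Topology

/-- The first-order partial derivative of a function on `ℝ²` in direction `w`. -/
noncomputable def pdv (w : ℝ × ℝ) (f : ℝ × ℝ → ℝ) : ℝ × ℝ → ℝ :=
  fun p => fderiv ℝ f p w

/-- The Laplacian `Δ = ∂²/∂x² + ∂²/∂y²` of a function on `ℝ²`. -/
noncomputable def fLap (f : ℝ × ℝ → ℝ) : ℝ × ℝ → ℝ :=
  fun p => pdv (1, 0) (pdv (1, 0) f) p + pdv (0, 1) (pdv (0, 1) f) p

open Asymptotics InnerProductSpace

theorem two_le_smooth : (2 : WithTop ℕ∞) ≤ ((⊤ : ℕ∞) : WithTop ℕ∞) :=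
  WithTop.coe_le_coe.2 (le_top : (2 : ℕ∞) ≤ ⊤)

theorem bigO_of_fderiv {E F : Type*} [NormedAddCommGroup E] [NormedSpace ℝ E]
    [NormedAddCommGroup F] [NormedSpace ℝ F] {f : E → F} {n : ℕ}
    (hd : ∀ᶠ x in 𝓝 (0 : E), DifferentiableAt ℝ f x) (h0 : f 0 = 0)
    (h : (fderiv ℝ f) =O[𝓝 0] (fun x : E => ‖x‖ ^ n)) :
    f =O[𝓝 0] (fun x : E => ‖x‖ ^ (n + 1)) := by
  obtain ⟨C, hC⟩ := h.bound
  obtain ⟨r, hr, hb⟩ := Metric.eventually_nhds_iff_ball.1 (hd.and hC)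
  refine IsBigO.of_bound |C| ?_
  filter_upwards [Metric.ball_mem_nhds (0 : E) hr] with x hx
  have hx' : ‖x‖ < r := by simpa using hx
  have hC0 : ∀ y ∈ Metric.closedBall (0 : E) ‖x‖, y ∈ Metric.ball (0 : E) r := by
    intro y hy
    simp only [Metric.mem_closedBall, dist_zero_right, Metric.mem_ball] at hy ⊢
    linarith
  have hCn : ∀ y ∈ Metric.closedBall (0 : E) ‖x‖, ‖fderiv ℝ f y‖ ≤ |C| * ‖x‖ ^ n := by
    intro y hy
    have h1 := (hb y (hC0 y hy)).2
    have hy' : ‖y‖ ≤ ‖x‖ := by simpa using hy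
    calc _ ≤ C * ‖‖y‖ ^ n‖ := h1
      _ ≤ |C| * ‖x‖ ^ n := by
        rw [norm_pow, norm_norm]
        gcongr
        exact le_abs_self C
  have h2 := (convex_closedBall (0 : E) ‖x‖).norm_image_sub_le_of_norm_fderiv_le
    (fun y hy => (hb y (hC0 y hy)).1) hCn (x := 0) (y := x) (by simp) (by simp)
  rw [h0, sub_zero, sub_zero] at h2
  rw [norm_pow, norm_norm, pow_succ, ← mul_assoc]
  exact h2

theorem analytic_factor {F : ℂ → ℂ} (hF : AnalyticAt ℂ F 0) (n : ℕ)
    (h : F =O[𝓝 0] (fun z : ℂ => ‖z‖ ^ n)) :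
    ∃ G : ℂ → ℂ, AnalyticAt ℂ G 0 ∧ ∀ᶠ z in 𝓝 0, F z = z ^ n * G z := by
  induction n with
  | zero => exact ⟨F, hF, by simp⟩
  | succ n ih =>
    obtain ⟨G, hG, hFG⟩ := ih (h.trans (IsBigO.of_bound 1 (by
      filter_upwards [Metric.ball_mem_nhds (0 : ℂ) one_pos] with z hz
      have : ‖z‖ < 1 := by simpa using hz
      simp only [norm_pow, norm_norm, one_mul]
      exact pow_le_pow_of_le_one (norm_nonneg _) this.le (Nat.le_succ n))))
    have hG0 : G 0 = 0 := by
      obtain ⟨C, hC⟩ := h.bound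
      have h1 : Tendsto G (𝓝[≠] 0) (𝓝 0) := by
        refine squeeze_zero_norm' (a := fun z => C * ‖z‖) ?_ ?_
        · filter_upwards [nhdsWithin_le_nhds hC, nhdsWithin_le_nhds hFG, self_mem_nhdsWithin]
            with z h1 h2 h3
          have h3' : 0 < ‖z‖ := norm_pos_iff.2 h3
          rw [h2] at h1
          simp only [norm_mul, norm_pow, norm_norm] at h1
          have h4 : ‖z‖ ^ n * ‖G z‖ ≤ ‖z‖ ^ n * (C * ‖z‖) := by
            rw [pow_succ] at h1; linarith
          exact le_of_mul_le_mul_left h4 (by positivity)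
        · have : Tendsto (fun z : ℂ => C * ‖z‖) (𝓝 0) (𝓝 (C * ‖(0:ℂ)‖)) :=
            (continuous_const.mul continuous_norm).tendsto 0
          simp only [norm_zero, mul_zero] at this
          exact this.mono_left nhdsWithin_le_nhds
      exact tendsto_nhds_unique (hG.continuousAt.tendsto.mono_left nhdsWithin_le_nhds) h1
    have h1 : (1 : ℕ) ≤ analyticOrderAt G 0 := by
      rw [Nat.cast_one, Order.one_le_iff_ne_zero, hG.analyticOrderAt_ne_zero]
      exact hG0
    obtain ⟨K, hK, hGK⟩ := (natCast_le_analyticOrderAt hG).1 h1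
    refine ⟨K, hK, ?_⟩
    filter_upwards [hFG, hGK] with z h1 h2
    rw [h1, h2]; simp; ring

theorem re_factor_s1 {F : ℂ → ℂ} (hF : AnalyticAt ℂ F 0) (n : ℕ) (hn : n ≠ 0)
    (h : (fun z => (F z).re) =O[𝓝 0] (fun z : ℂ => ‖z‖ ^ n)) :
    ∃ G : ℂ → ℂ, AnalyticAt ℂ G 0 ∧ ∀ᶠ z in 𝓝 0, (F z).re = (z ^ n * G z).re := by
  have hF0 : (F 0).re = 0 := by
    obtain ⟨C, hC⟩ := h.bound
    have := hC.self_of_nhds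
    simpa [hn] using this
  set F₁ : ℂ → ℂ := fun z => F z - F 0 with hF₁
  have hF₁a : AnalyticAt ℂ F₁ 0 := hF.sub analyticAt_const
  have hre : ∀ z, (F₁ z).re = (F z).re := by intro z; simp [hF₁, hF0]
  have hO : F₁ =O[𝓝 0] (fun z : ℂ => ‖z‖ ^ n) := by
    obtain ⟨C, hC0, hC⟩ := h.exists_pos
    obtain ⟨r, hr, hb⟩ := Metric.eventually_nhds_iff_ball.1
      (hF₁a.eventually_analyticAt.and hC.bound)
    refine IsBigO.of_bound (2 * (C * 2 ^ n)) ?_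
    filter_upwards [Metric.ball_mem_nhds (0 : ℂ) (half_pos hr)] with z hz
    rcases eq_or_ne z 0 with rfl | hz0
    · simp [hF₁, hn]
    have hzp : 0 < ‖z‖ := norm_pos_iff.2 hz0
    have hz' : ‖z‖ < r / 2 := by simpa using hz
    have hsub : ∀ y ∈ Metric.ball (0 : ℂ) (2 * ‖z‖), y ∈ Metric.ball (0 : ℂ) r := by
      intro y hy
      simp only [Metric.mem_ball, dist_zero_right] at hy ⊢
      linarith
    have := Complex.borelCaratheodory_zero (f := F₁) (R := 2 * ‖z‖) (z := z)
      (M := C * (2 * ‖z‖) ^ n) (by positivity)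
      (fun y hy => (hb y (hsub y hy)).1.differentiableAt.differentiableWithinAt)
      (by
        intro y hy
        have h1 := (hb y (hsub y hy)).2
        have hy' : ‖y‖ < 2 * ‖z‖ := by simpa using hy
        change (F₁ y).re ≤ _
        rw [hre]
        refine (le_abs_self _).trans (h1.trans ?_)
        rw [norm_pow, norm_norm]
        gcongr) (by positivity) (by simp only [Metric.mem_ball, dist_zero_right]; linarith) (by simp [hF₁])
    refine this.trans (le_of_eq ?_)
    rw [norm_pow, norm_norm, mul_pow]
    field_simp
    ring
  obtain ⟨G, hG, hE⟩ := analytic_factor hF₁a n hO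
  refine ⟨G, hG, ?_⟩
  filter_upwards [hE] with z hz
  rw [← hre, hz]

theorem bigO_of_vanish {E : Type} [NormedAddCommGroup E] [NormedSpace ℝ E]
    (n : ℕ) : ∀ {F : Type} [NormedAddCommGroup F] [NormedSpace ℝ F] {f : E → F},
    ContDiffAt ℝ (⊤ : ℕ∞) f 0 → (∀ j, j < n → iteratedFDeriv ℝ j f 0 = 0) →
    f =O[𝓝 0] (fun x : E => ‖x‖ ^ n) := by
  induction n with
  | zero =>
    intro F _ _ f hf _
    simpa using hf.continuousAt.isBigO_one ℝ
  | succ n ih =>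
    intro F _ _ f hf h
    have hd : ∀ᶠ x in 𝓝 (0 : E), DifferentiableAt ℝ f x := by
      have h1 : ContDiffAt ℝ 1 f 0 := hf.of_le (by simp)
      filter_upwards [h1.eventually (by simp)] with x hx
      exact hx.differentiableAt (by simp)
    refine bigO_of_fderiv hd ?_ (ih (hf.fderiv_right (by rfl)) ?_)
    · have := h 0 (Nat.succ_pos n)
      rw [← norm_eq_zero, norm_iteratedFDeriv_zero] at this
      exact norm_eq_zero.1 this
    · intro j hj
      rw [← norm_eq_zero, norm_iteratedFDeriv_fderiv, h (j + 1) (by omega), norm_zero]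

theorem harmonic_re {u : ℂ → ℝ} (hu : HarmonicAt u 0) :
    ∃ F : ℂ → ℂ, AnalyticAt ℂ F 0 ∧ ∀ᶠ z in 𝓝 0, u z = (F z).re := by
  obtain ⟨r, hr, hb⟩ := Metric.eventually_nhds_iff_ball.1 hu.eventually
  obtain ⟨F, hF, hE⟩ := InnerProductSpace.HarmonicOnNhd.exists_analyticOnNhd_ball_re_eq
    (f := u) (z := 0) (R := r) (fun y hy => hb y hy)
  refine ⟨F, hF 0 (Metric.mem_ball_self hr), ?_⟩
  filter_upwards [Metric.ball_mem_nhds (0 : ℂ) hr] with z hz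
  exact (hE hz).symm

theorem lap_apply {F : Type*} [NormedAddCommGroup F] [NormedSpace ℝ F] (S : ℂ → F) (z : ℂ) :
    Laplacian.laplacian S z = fderiv ℝ (fderiv ℝ S) z 1 1
      + fderiv ℝ (fderiv ℝ S) z Complex.I Complex.I := by
  rw [laplacian_eq_iteratedFDeriv_complexPlane]
  simp [iteratedFDeriv_two_apply]

theorem fderiv_fderiv_apply {E F : Type*} [NormedAddCommGroup E] [NormedSpace ℝ E]
    [NormedAddCommGroup F] [NormedSpace ℝ F] {f : E → F} {z : E} (hf : ContDiffAt ℝ 2 f z)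
    (w : E) : fderiv ℝ (fun y => fderiv ℝ f y w) z w = fderiv ℝ (fderiv ℝ f) z w w := by
  have h1 : DifferentiableAt ℝ (fderiv ℝ f) z :=
    (hf.fderiv_right (m := 1) (by norm_num)).differentiableAt (by simp)
  rw [fderiv_clm_apply h1 (by fun_prop)]
  simp

theorem lap_conj_mul {f : ℂ → ℂ} (hf : AnalyticAt ℂ f 0) :
    ∀ᶠ z in 𝓝 0, Laplacian.laplacian (fun z => (starRingEnd ℂ z * f z).re) z
      = 4 * (deriv f z).re := by
  have hA := hf.eventually_analyticAt
  filter_upwards [hA.eventually_nhds] with z hz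
  have hz0 : AnalyticAt ℂ f z := hz.self_of_nhds
  have hsm : ContDiffAt ℝ 2 (fun z => (starRingEnd ℂ z * f z)) z := by
    have h1 : ContDiffAt ℝ 2 f z := hz0.contDiffAt.restrict_scalars ℝ
    have h2 : ContDiffAt ℝ 2 (fun z => starRingEnd ℂ z) z :=
      Complex.conjCLE.contDiff.contDiffAt
    exact h2.mul h1
  have hre : (fun z => (starRingEnd ℂ z * f z).re) =
    Complex.reCLM ∘ (fun z => (starRingEnd ℂ z * f z)) := rfl
  rw [hre, hsm.laplacian_CLM_comp_left, Function.comp_apply, lap_apply]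
  have hconj : ∀ y, HasFDerivAt (fun z => starRingEnd ℂ z) (Complex.conjCLE : ℂ →L[ℝ] ℂ) y :=
    fun y => Complex.conjCLE.hasFDerivAt
  have hd : ∀ w, (fun y => fderiv ℝ (fun z => (starRingEnd ℂ z * f z)) y w) =ᶠ[𝓝 z]
      (fun y => starRingEnd ℂ y * (deriv f y * w) + f y * starRingEnd ℂ w) := by
    intro w
    filter_upwards [hz] with y hy
    have h1 := (hconj y).mul (hy.differentiableAt.hasDerivAt.hasFDerivAt.restrictScalars ℝ)
    rw [show fderiv ℝ (fun z => (starRingEnd ℂ z * f z)) y = _ from h1.fderiv]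
    simp [mul_comm]
  have hdd : ∀ w, fderiv ℝ (fderiv ℝ (fun z => (starRingEnd ℂ z * f z))) z w w =
      starRingEnd ℂ z * (deriv (deriv f) z * w * w) + 2 * deriv f z * w * starRingEnd ℂ w := by
    intro w
    rw [← fderiv_fderiv_apply hsm, (hd w).fderiv_eq]
    have h1 := (hz0.deriv.differentiableAt.hasDerivAt.hasFDerivAt.restrictScalars ℝ)
    have h2 := (hz0.differentiableAt.hasDerivAt.hasFDerivAt.restrictScalars ℝ)
    have h3 := ((hconj z).mul (h1.mul_const w)).add (h2.mul_const (starRingEnd ℂ w))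
    rw [show fderiv ℝ (fun y => starRingEnd ℂ y * (deriv f y * w) + f y * starRingEnd ℂ w) z = _
      from h3.fderiv]
    simp
    ring
  rw [hdd, hdd]
  have : starRingEnd ℂ z * (deriv (deriv f) z * 1 * 1) + 2 * deriv f z * 1 * starRingEnd ℂ 1 +
    (starRingEnd ℂ z * (deriv (deriv f) z * Complex.I * Complex.I) + 2 * deriv f z * Complex.I *
     starRingEnd ℂ Complex.I) = 4 * deriv f z := by
    simp only [map_one, Complex.conj_I]
    linear_combination (starRingEnd ℂ z * deriv (deriv f) z - 2 * deriv f z) * Complex.I_mul_I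
  rw [this]
  simp


theorem decomp {S : ℂ → ℝ} {k : ℕ} (hk : 2 ≤ k) (hS : ContDiffAt ℝ (⊤ : ℕ∞) S 0)
    (hv : ∀ j, j < k + 1 → iteratedFDeriv ℝ j S 0 = 0)
    (h2 : Laplacian.laplacian (Laplacian.laplacian S) =ᶠ[𝓝 0] 0) :
    ∃ A B : ℂ → ℂ, AnalyticAt ℂ A 0 ∧ AnalyticAt ℂ B 0 ∧
      ∀ᶠ z in 𝓝 0, S z = (starRingEnd ℂ z * (z ^ k * A z) + z ^ (k + 1) * B z).re := by
  have hdS : ContDiffAt ℝ (⊤ : ℕ∞) (fderiv ℝ S) 0 := hS.fderiv_right (by rfl)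
  have hddS : ContDiffAt ℝ (⊤ : ℕ∞) (fderiv ℝ (fderiv ℝ S)) 0 := hdS.fderiv_right (by rfl)
  have hlap : Laplacian.laplacian S = fun z => fderiv ℝ (fderiv ℝ S) z 1 1
      + fderiv ℝ (fderiv ℝ S) z Complex.I Complex.I := funext (lap_apply S)
  have hlapS : ContDiffAt ℝ (⊤ : ℕ∞) (Laplacian.laplacian S) 0 := by
    rw [hlap]
    exact ((hddS.clm_apply contDiffAt_const).clm_apply contDiffAt_const).add
      ((hddS.clm_apply contDiffAt_const).clm_apply contDiffAt_const)
  have hSO : S =O[𝓝 0] (fun x : ℂ => ‖x‖ ^ (k + 1)) := bigO_of_vanish (k + 1) hS hv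
  have hddO : fderiv ℝ (fderiv ℝ S) =O[𝓝 0] (fun x : ℂ => ‖x‖ ^ (k - 1)) := by
    refine bigO_of_vanish (k - 1) hddS ?_
    intro j hj
    rw [← norm_eq_zero, norm_iteratedFDeriv_fderiv, norm_iteratedFDeriv_fderiv,
      hv (j + 1 + 1) (by omega), norm_zero]
  have hlapO : Laplacian.laplacian S =O[𝓝 0] (fun x : ℂ => ‖x‖ ^ (k - 1)) := by
    obtain ⟨C, hC⟩ := hddO.bound
    refine IsBigO.of_bound (2 * C) (hC.mono fun z hz => ?_)
    have hw : ∀ w : ℂ, ‖w‖ = 1 → ‖fderiv ℝ (fderiv ℝ S) z w w‖ ≤ ‖fderiv ℝ (fderiv ℝ S) z‖ := by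
      intro w hw
      have := (fderiv ℝ (fderiv ℝ S) z).le_opNorm₂ w w
      simpa [hw] using this
    rw [lap_apply]
    have := norm_add_le (fderiv ℝ (fderiv ℝ S) z 1 1)
      (fderiv ℝ (fderiv ℝ S) z Complex.I Complex.I)
    linarith [hw 1 (by simp), hw Complex.I (by simp)]
  have hharm : HarmonicAt (Laplacian.laplacian S) 0 := ⟨hlapS.of_le two_le_smooth, h2⟩
  obtain ⟨F, hF, hFE⟩ := harmonic_re hharm
  obtain ⟨G, hG, hGE⟩ := re_factor_s1 hF (k - 1) (by omega) (hlapO.congr' hFE EventuallyEq.rfl)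
  -- primitive
  set P : ℂ → ℂ := fun z => z ^ (k - 1) * G z / 4 with hP
  have hPa : AnalyticAt ℂ P 0 := by
    have : AnalyticAt ℂ (fun z : ℂ => z ^ (k - 1)) 0 := by fun_prop
    exact (this.mul hG).div_const
  obtain ⟨r, hr, hb⟩ := Metric.eventually_nhds_iff_ball.1 hPa.eventually_analyticAt
  have hPd : DifferentiableOn ℂ P (Metric.ball 0 r) :=
    fun y hy => (hb y hy).differentiableAt.differentiableWithinAt
  obtain ⟨f, hf0, hf⟩ := hPd.isExactOn_ball.with_val_at 0 0
  have hfa : AnalyticAt ℂ f 0 :=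
    DifferentiableOn.analyticAt (s := Metric.ball 0 r)
      (fun y hy => (hf y hy).differentiableAt.differentiableWithinAt)
      (Metric.ball_mem_nhds 0 hr)
  have hfd : ∀ᶠ z in 𝓝 0, HasDerivAt f (P z) z := by
    filter_upwards [Metric.ball_mem_nhds (0 : ℂ) hr] with z hz using hf z hz
  have hPO : P =O[𝓝 0] (fun x : ℂ => ‖x‖ ^ (k - 1)) := by
    have h1 : G =O[𝓝 0] (fun _ => (1 : ℝ)) := hG.continuousAt.isBigO_one ℝ
    have h2 : (fun z : ℂ => z ^ (k - 1)) =O[𝓝 0] (fun x : ℂ => ‖x‖ ^ (k - 1)) :=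
      IsBigO.of_bound 1 (by simp)
    have h3 := (h2.mul h1).const_mul_left (1 / 4 : ℂ)
    simp only [mul_one] at h3
    refine h3.congr_left fun z => ?_
    rw [hP]; ring
  have hfO : f =O[𝓝 0] (fun x : ℂ => ‖x‖ ^ k) := by
    have := bigO_of_fderiv (f := f) (n := k - 1)
      (hfd.mono fun z hz => hz.differentiableAt.restrictScalars ℝ) hf0 ?_
    · rwa [Nat.sub_add_cancel (by omega)] at this
    · refine IsBigO.trans (IsBigO.of_bound 1 ?_) hPO
      filter_upwards [hfd] with z hz
      rw [(hz.hasFDerivAt.restrictScalars ℝ).fderiv]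
      simp
  obtain ⟨A, hA, hAE⟩ := analytic_factor hfa k hfO
  -- the harmonic remainder
  set Q : ℂ → ℝ := fun z => (starRingEnd ℂ z * f z).re with hQ
  have hQs : ContDiffAt ℝ 2 Q 0 := by
    have h1 : ContDiffAt ℝ 2 f 0 := hfa.contDiffAt.restrict_scalars ℝ
    have h2 : ContDiffAt ℝ 2 (fun z => starRingEnd ℂ z) (0 : ℂ) :=
      Complex.conjCLE.contDiff.contDiffAt
    exact Complex.reCLM.contDiff.contDiffAt.comp 0 (h2.mul h1)
  have hS2 : ContDiffAt ℝ 2 S 0 := hS.of_le two_le_smooth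
  have hH : HarmonicAt (S - Q) 0 := by
    refine ⟨hS2.sub hQs, ?_⟩
    filter_upwards [hS2.laplacian_sub_nhds hQs, lap_conj_mul hfa, hFE, hGE, hfd]
      with z h1 h2 h3 h4 h5
    rw [h1, Pi.sub_apply, h2, h3, h4, h5.deriv, hP]
    simp only [Pi.zero_apply]
    have : (z ^ (k - 1) * G z / 4).re = (z ^ (k - 1) * G z).re / 4 := by
      simp
    rw [this]; ring
  have hQO : Q =O[𝓝 0] (fun x : ℂ => ‖x‖ ^ (k + 1)) := by
    have h2 : (fun z : ℂ => starRingEnd ℂ z) =O[𝓝 0] (fun x : ℂ => ‖x‖) :=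
      IsBigO.of_bound 1 (by simp)
    have h3 := h2.mul hfO
    refine IsBigO.trans (IsBigO.of_bound 1 (Eventually.of_forall fun z => ?_))
      (h3.congr_right fun z => (pow_succ' ‖z‖ k).symm)
    rw [one_mul]
    exact Complex.abs_re_le_norm _
  obtain ⟨F₂, hF₂, hF₂E⟩ := harmonic_re hH
  obtain ⟨B, hB, hBE⟩ := re_factor_s1 hF₂ (k + 1) (by omega)
    ((hSO.sub hQO).congr' hF₂E EventuallyEq.rfl)
  refine ⟨A, B, hA, hB, ?_⟩
  filter_upwards [hF₂E, hBE, hAE] with z h1 h2 h3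
  rw [Complex.add_re, ← h2, ← h1, ← h3]
  simp [hQ]

theorem toFun2_hasFDerivAt (p : MvPolynomial (Fin 2) ℝ) (q : ℝ × ℝ) :
    HasFDerivAt (toFun2 p) (toFun2 (pderiv 0 p) q • ContinuousLinearMap.fst ℝ ℝ ℝ
      + toFun2 (pderiv 1 p) q • ContinuousLinearMap.snd ℝ ℝ ℝ) q := by
  induction p using MvPolynomial.induction_on with
  | C a =>
    have : toFun2 (C a) = fun _ => a := by ext; simp [toFun2]
    rw [this]
    refine HasFDerivAt.congr_fderiv (hasFDerivAt_const a q) ?_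
    simp [toFun2]
  | add p₁ p₂ h₁ h₂ =>
    have : toFun2 (p₁ + p₂) = fun x => toFun2 p₁ x + toFun2 p₂ x := by ext; simp [toFun2]
    rw [this]
    refine HasFDerivAt.congr_fderiv (h₁.fun_add h₂) ?_
    ext <;> simp [toFun2]
  | mul_X p i h =>
    fin_cases i
    · have : toFun2 (p * X 0) = fun x => toFun2 p x * x.1 := by ext; simp [toFun2]
      simp only [Fin.zero_eta, this]
      refine HasFDerivAt.congr_fderiv (h.fun_mul (hasFDerivAt_fst (𝕜 := ℝ) (p := q))) ?_
      ext <;> simp [toFun2]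
    · have : toFun2 (p * X 1) = fun x => toFun2 p x * x.2 := by ext; simp [toFun2]
      simp only [Fin.mk_one, this]
      refine HasFDerivAt.congr_fderiv (h.fun_mul (hasFDerivAt_snd (𝕜 := ℝ) (p := q))) ?_
      ext <;> simp [toFun2]

theorem toFun2_contDiff (p : MvPolynomial (Fin 2) ℝ) (n : WithTop ℕ∞) :
    ContDiff ℝ n (toFun2 p) := by
  induction p using MvPolynomial.induction_on with
  | C a =>
    have : toFun2 (C a) = fun _ => a := by ext; simp [toFun2]
    rw [this]
    exact contDiff_const
  | add p₁ p₂ h₁ h₂ =>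
    have : toFun2 (p₁ + p₂) = fun x => toFun2 p₁ x + toFun2 p₂ x := by ext; simp [toFun2]
    rw [this]
    exact h₁.add h₂
  | mul_X p i h =>
    fin_cases i
    · have : toFun2 (p * X 0) = fun x => toFun2 p x * x.1 := by ext; simp [toFun2]
      simp only [Fin.zero_eta, this]
      exact h.mul contDiff_fst
    · have : toFun2 (p * X 1) = fun x => toFun2 p x * x.2 := by ext; simp [toFun2]
      simp only [Fin.mk_one, this]
      exact h.mul contDiff_snd

theorem fLap_toFun2 (p : MvPolynomial (Fin 2) ℝ) : fLap (toFun2 p) = toFun2 (pLap p) := by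
  have h0 : ∀ p, pdv (1, 0) (toFun2 p) = toFun2 (pderiv 0 p) := by
    intro p; ext q; simp [pdv, (toFun2_hasFDerivAt p q).fderiv]
  have h1 : ∀ p, pdv (0, 1) (toFun2 p) = toFun2 (pderiv 1 p) := by
    intro p; ext q; simp [pdv, (toFun2_hasFDerivAt p q).fderiv]
  ext q
  simp only [fLap, h0, h1]
  simp [toFun2, pLap]

theorem iteratedFDeriv_comp_e (f : ℝ × ℝ → ℝ) (z : ℂ) (i : ℕ) :
    iteratedFDeriv ℝ i (f ∘ Complex.equivRealProdCLM) z =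
      (iteratedFDeriv ℝ i f (Complex.equivRealProdCLM z)).compContinuousLinearMap
        fun _ => (Complex.equivRealProdCLM : ℂ →L[ℝ] ℝ × ℝ) := by
  have := Complex.equivRealProdCLM.iteratedFDerivWithin_comp_right f uniqueDiffOn_univ
    (x := z) (Set.mem_univ _) i
  simpa [iteratedFDerivWithin_univ] using this

theorem lap_comp_e {f : ℝ × ℝ → ℝ} {z : ℂ} (hf : ContDiffAt ℝ 2 f (Complex.equivRealProdCLM z)) :
    Laplacian.laplacian (f ∘ Complex.equivRealProdCLM) z = fLap f (Complex.equivRealProdCLM z) := by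
  rw [laplacian_eq_iteratedFDeriv_complexPlane]
  simp only [iteratedFDeriv_comp_e, ContinuousMultilinearMap.compContinuousLinearMap_apply,
    iteratedFDeriv_two_apply]
  unfold fLap pdv
  rw [fderiv_fderiv_apply hf, fderiv_fderiv_apply hf]
  have h1 : Complex.equivRealProdCLM 1 = (1, 0) := by
    simp [Complex.equivRealProdCLM_apply]
  have h2 : Complex.equivRealProdCLM Complex.I = (0, 1) := by
    simp [Complex.equivRealProdCLM_apply]
  simp [h1, h2]

theorem toFun2_smul {k : ℕ} {h : MvPolynomial (Fin 2) ℝ} (hhom : h.IsHomogeneous k)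
    (t : ℝ) (q : ℝ × ℝ) : toFun2 h (t • q) = t ^ k * toFun2 h q := by
  unfold toFun2
  rw [eval_eq', eval_eq', Finset.mul_sum]
  refine Finset.sum_congr rfl fun d hd => ?_
  have h1 : d 0 + d 1 = k := by
    have := hhom (mem_support_iff.1 hd)
    rw [← this]
    simp [Finsupp.weight_apply, Finsupp.sum_fintype, Fin.sum_univ_two]
  rw [← h1]
  simp only [Fin.prod_univ_two, Prod.smul_fst, Prod.smul_snd, smul_eq_mul, Matrix.cons_val_zero,
    Matrix.cons_val_one]
  ring

theorem poly_form {k : ℕ} (hk : k ≠ 0) {h : MvPolynomial (Fin 2) ℝ} (hne : h ≠ 0)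
    (hhom : h.IsHomogeneous k) (hharm : pLap h = 0) :
    ∃ c : ℂ, c ≠ 0 ∧ ∀ z, toFun2 h (Complex.equivRealProdCLM z) = (c * z ^ k).re := by
  set u : ℂ → ℝ := toFun2 h ∘ Complex.equivRealProdCLM with hu
  have hs : ∀ (t : ℝ) (z : ℂ), u ((t : ℂ) * z) = t ^ k * u z := by
    intro t z
    rw [hu, Function.comp_apply, Function.comp_apply, ← toFun2_smul hhom, ← map_smul]
    simp
  have huc : ContDiff ℝ 2 u := (toFun2_contDiff h 2).comp Complex.equivRealProdCLM.contDiff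
  have hharm' : HarmonicAt u 0 := by
    refine ⟨huc.contDiffAt, Eventually.of_forall fun z => ?_⟩
    rw [hu, lap_comp_e (toFun2_contDiff h 2).contDiffAt, fLap_toFun2, hharm]
    simp [toFun2]
  have hO : u =O[𝓝 0] (fun z : ℂ => ‖z‖ ^ k) := by
    obtain ⟨C, hC⟩ := (isCompact_sphere (0 : ℂ) 1).exists_bound_of_continuousOn
      huc.continuous.continuousOn
    refine IsBigO.of_bound C (Eventually.of_forall fun z => ?_)
    rcases eq_or_ne z 0 with rfl | hz
    · have := hs 0 0
      simp [hk] at this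
      simp [this, hk]
    · have hz' : (‖z‖ : ℂ) ≠ 0 := by simpa using hz
      have h1 := hs ‖z‖ (z / ‖z‖)
      rw [mul_div_cancel₀ _ hz'] at h1
      have h2 := hC (z / ‖z‖) (by simp [hz])
      rw [h1, norm_mul, norm_pow, norm_norm, mul_comm]
      gcongr
  obtain ⟨F, hF, hFE⟩ := harmonic_re hharm'
  obtain ⟨G, hG, hGE⟩ := re_factor_s1 hF k hk (hO.congr' hFE EventuallyEq.rfl)
  have hform : ∀ z, u z = (G 0 * z ^ k).re := by
    intro z
    have ht : Tendsto (fun t : ℝ => (t : ℂ) * z) (𝓝[≠] 0) (𝓝 0) := by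
      have : Continuous (fun t : ℝ => (t : ℂ) * z) := by fun_prop
      have h1 := this.tendsto 0
      simp only [Complex.ofReal_zero, zero_mul] at h1
      exact h1.mono_left nhdsWithin_le_nhds
    have h1 : ∀ᶠ t : ℝ in 𝓝[≠] 0, u z = (G ((t : ℂ) * z) * z ^ k).re := by
      filter_upwards [ht.eventually hFE, ht.eventually hGE, self_mem_nhdsWithin] with t h1 h2 h3
      rw [h2, hs, mul_pow] at h1
      have h4 : (t : ℂ) ^ k * z ^ k * G (t * z) = ((t ^ k : ℝ) : ℂ) * (G (t * z) * z ^ k) := by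
        push_cast; ring
      rw [h4, Complex.re_ofReal_mul] at h1
      exact mul_left_cancel₀ (pow_ne_zero k h3) h1
    have h2 : Tendsto (fun t : ℝ => (G ((t : ℂ) * z) * z ^ k).re) (𝓝[≠] 0)
        (𝓝 (G 0 * z ^ k).re) :=
      (Complex.continuous_re.tendsto _).comp
        ((hG.continuousAt.tendsto.comp ht).mul_const (z ^ k))
    exact tendsto_nhds_unique (tendsto_const_nhds.congr' h1) h2
  refine ⟨G 0, ?_, hform⟩
  intro h0
  apply hne
  apply MvPolynomial.funext
  intro x
  have := hform (Complex.equivRealProdCLM.symm (x 0, x 1))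
  rw [h0, hu, Function.comp_apply, ContinuousLinearEquiv.apply_symm_apply] at this
  have hx : ![x 0, x 1] = x := by ext i; fin_cases i <;> rfl
  simpa [toFun2, hx] using this

theorem biharmonic_perturbation_right_equivalent
    (k : ℕ) (hk : 5 ≤ k)
    (h : MvPolynomial (Fin 2) ℝ) (hne : h ≠ 0)
    (hhom : h.IsHomogeneous k) (hharm : pLap h = 0)
    (R : ℝ × ℝ → ℝ) (hRs : ContDiffAt ℝ (⊤ : ℕ∞) R 0) (hRm : VanishTo (k + 1) R)
    (hR2 : fLap (fLap R) =ᶠ[nhds 0] 0) :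
    RightEquiv (toFun2 h) (fun q => toFun2 h q + R q) := by
  have hk0 : k ≠ 0 := by omega
  set e := Complex.equivRealProdCLM with he
  have he0 : e 0 = 0 := map_zero e
  have het : Tendsto e (𝓝 0) (𝓝 0) := by simpa [he0] using e.continuous.tendsto 0
  have hest : Tendsto e.symm (𝓝 0) (𝓝 0) := by
    simpa [map_zero] using e.symm.continuous.tendsto 0
  obtain ⟨c, hc, hform⟩ := poly_form hk0 hne hhom hharm
  set S : ℂ → ℝ := R ∘ e with hS
  have hSs : ContDiffAt ℝ (⊤ : ℕ∞) S 0 :=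
    ContDiffAt.comp 0 (by rw [he0]; exact hRs) e.contDiff.contDiffAt
  have hSv : ∀ j, j < k + 1 → iteratedFDeriv ℝ j S 0 = 0 := by
    intro j hj
    rw [hS, iteratedFDeriv_comp_e, ← he, he0, hRm j hj]
    ext; simp
  have hR2s : ContDiffAt ℝ 2 R 0 := hRs.of_le two_le_smooth
  have hlapS : Laplacian.laplacian S =ᶠ[𝓝 0] (fLap R) ∘ e := by
    filter_upwards [het.eventually (hR2s.eventually (by simp))] with z hz
    exact lap_comp_e hz
  have hLs : ContDiffAt ℝ 2 (fLap R) 0 := by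
    have hd : ∀ (w : ℝ × ℝ) (f : ℝ × ℝ → ℝ), ContDiffAt ℝ (⊤ : ℕ∞) f 0 →
        ContDiffAt ℝ (⊤ : ℕ∞) (pdv w f) 0 := fun w f hf =>
      (hf.fderiv_right (by rfl)).clm_apply contDiffAt_const
    exact ((hd _ _ (hd _ _ hRs)).add (hd _ _ (hd _ _ hRs))).of_le
      two_le_smooth
  have hlaplap : Laplacian.laplacian (Laplacian.laplacian S) =ᶠ[𝓝 0] 0 := by
    filter_upwards [laplacian_congr_nhds hlapS, het.eventually (hLs.eventually (by simp)),
      het.eventually hR2] with z h1 h2 h3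
    rw [h1, lap_comp_e h2, h3]; rfl
  obtain ⟨A, B, hA, hB, hSE⟩ := decomp (by omega) hSs hSv hlaplap
  set W : ℂ → ℂ := fun z => 1 + (starRingEnd ℂ z * A z + z * B z) / c with hW
  have hW0 : W 0 = 1 := by simp [hW]
  have hWs : ContDiffAt ℝ (⊤ : ℕ∞) W 0 := by
    have h1 : ContDiffAt ℝ (⊤ : ℕ∞) A 0 := hA.contDiffAt.restrict_scalars ℝ
    have h2 : ContDiffAt ℝ (⊤ : ℕ∞) B 0 := hB.contDiffAt.restrict_scalars ℝ
    have h3 : ContDiffAt ℝ (⊤ : ℕ∞) (fun z => starRingEnd ℂ z) (0 : ℂ) :=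
      Complex.conjCLE.contDiff.contDiffAt
    exact contDiffAt_const.add (((h3.mul h1).add (contDiffAt_id.mul h2)).div_const c)
  set V : ℂ → ℂ := fun z => W z ^ ((k : ℂ)⁻¹) with hV
  have hV0 : V 0 = 1 := by simp [hV, hW0]
  have hVs : ContDiffAt ℝ (⊤ : ℕ∞) V 0 := by
    have h1 : AnalyticAt ℂ (fun w : ℂ => w ^ ((k : ℂ)⁻¹)) (W 0) :=
      analyticAt_id.cpow analyticAt_const (by simp [hW0])
    have h2 : ContDiffAt ℝ (⊤ : ℕ∞) (fun w : ℂ => w ^ ((k : ℂ)⁻¹)) (W 0) :=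
      h1.contDiffAt.restrict_scalars ℝ
    exact h2.comp 0 hWs
  set φ : ℂ → ℂ := fun z => z * V z with hφ
  have hφ0 : φ 0 = 0 := by simp [hφ]
  have hφs : ContDiffAt ℝ (⊤ : ℕ∞) φ 0 := contDiffAt_id.mul hVs
  have hφd : HasFDerivAt φ ((ContinuousLinearEquiv.refl ℝ ℂ : ℂ ≃L[ℝ] ℂ) : ℂ →L[ℝ] ℂ) 0 := by
    have h1 := (hasFDerivAt_id (𝕜 := ℝ) (0 : ℂ)).fun_mul
      (hVs.differentiableAt (by simp)).hasFDerivAt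
    refine HasFDerivAt.congr_fderiv (h1) ?_
    ext; simp [hV0]
  have htop : ((⊤ : ℕ∞) : WithTop ℕ∞) ≠ 0 := by simp
  have hstr := hφs.hasStrictFDerivAt' hφd htop
  set ψ := hφs.localInverse hφd htop with hψ
  have hψs : ContDiffAt ℝ (⊤ : ℕ∞) ψ 0 := by
    have := hφs.to_localInverse hφd htop
    rwa [hφ0] at this
  have hψ0 : ψ 0 = 0 := by
    have := hφs.localInverse_apply_image hφd htop
    rwa [hφ0] at this
  have hl : ∀ᶠ z in 𝓝 0, ψ (φ z) = z := hstr.eventually_left_inverse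
  have hr : ∀ᶠ z in 𝓝 0, φ (ψ z) = z := by
    have := hstr.eventually_right_inverse
    rwa [hφ0] at this
  have hes0 : e.symm 0 = 0 := map_zero e.symm
  have hconj : ∀ g : ℂ → ℂ, ContDiffAt ℝ (⊤ : ℕ∞) g 0 →
      ContDiffAt ℝ (⊤ : ℕ∞) (e ∘ g ∘ e.symm) 0 := fun g hg =>
    e.contDiff.contDiffAt.comp 0
      (ContDiffAt.comp 0 (by rw [hes0]; exact hg) e.symm.contDiff.contDiffAt)
  refine ⟨e ∘ φ ∘ e.symm, e ∘ ψ ∘ e.symm, hconj φ hφs, hconj ψ hψs, ?_, ?_, ?_, ?_, ?_⟩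
  · simp [hφ0]
  · simp [hψ0]
  · filter_upwards [hest.eventually hl] with q hq
    simp [hq]
  · filter_upwards [hest.eventually hr] with q hq
    simp [hq]
  · filter_upwards [hest.eventually hSE] with q hq
    have h1 : R q = S (e.symm q) := by simp [hS]
    have h2 : toFun2 h q = (c * (e.symm q) ^ k).re := by
      rw [← hform, ← he, e.apply_symm_apply]
    simp only [Function.comp_apply]
    rw [h1, h2, hq, hform, ← Complex.add_re]
    congr 1
    simp only [hφ, hV]
    rw [mul_pow, Complex.cpow_nat_inv_pow _ hk0]
    simp only [hW]
    field_simp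
    ring
end

section
/- Let k ≥ 1 and let h be a smooth function-germ (ℝ²,0) → (ℝ,0) which is harmonic (Δh = 0) and has order exactly k (all partial derivatives of h of order < k vanish at 0, and some partial derivative of order k does not vanish at 0). Then h is right equivalent to f_k, i.e. there is a diffeomorphism-germ φ : (ℝ²,0) → (ℝ²,0) with f_k ∘ φ = h. -/
open MvPolynomial Filter Topology

/-- The function `f_k = Re((x+iy)^k)` on `ℝ²`. -/
noncomputable def fkFun (k : ℕ) : ℝ × ℝ → ℝ :=
  fun p => (((p.1 : ℂ) + p.2 * Complex.I) ^ k).re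


section HarmonicHelpers

/-- Iterated derivatives commute with precomposition by a linear equivalence. -/
lemma iteratedFDeriv_comp_cle {E F G : Type*} [NormedAddCommGroup E] [NormedSpace ℝ E]
    [NormedAddCommGroup F] [NormedSpace ℝ F] [NormedAddCommGroup G] [NormedSpace ℝ G]
    (e : G ≃L[ℝ] E) (f : E → F) (x : G) (i : ℕ) :
    iteratedFDeriv ℝ i (f ∘ e) x =
      (iteratedFDeriv ℝ i f (e x)).compContinuousLinearMap fun _ => (e : G →L[ℝ] E) := by
  have := e.iteratedFDerivWithin_comp_right f uniqueDiffOn_univ (x := x) (Set.mem_univ _) i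
  simpa only [Set.preimage_univ, iteratedFDerivWithin_univ] using this

/-- Real iterated Fréchet derivatives of a holomorphic germ. -/
lemma iteratedFDeriv_holo (j : ℕ) : ∀ (G : ℂ → ℂ), AnalyticAt ℂ G 0 → ∀ v : Fin j → ℂ,
    iteratedFDeriv ℝ j G 0 v = iteratedDeriv j G 0 * ∏ i, v i := by
  induction j with
  | zero => intro G _ v; simp
  | succ j ih =>
    intro G hG v
    let L : ℂ →L[ℝ] (ℂ →L[ℝ] ℂ) := ContinuousLinearMap.mul ℝ ℂ
    have h1 : fderiv ℝ G =ᶠ[𝓝 0] L ∘ deriv G := by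
      filter_upwards [hG.eventually_analyticAt] with z hz
      rw [hz.differentiableAt.fderiv_restrictScalars (𝕜 := ℝ)]
      ext w
      simp [L, mul_comm]
    have hd : ContDiffAt ℝ j (deriv G) 0 := hG.deriv.contDiffAt.restrict_scalars ℝ
    rw [iteratedFDeriv_succ_apply_right, (h1.iteratedFDeriv ℝ j).eq_of_nhds,
      L.iteratedFDeriv_comp_left hd le_rfl]
    simp only [ContinuousLinearMap.compContinuousMultilinearMap_coe, Function.comp_apply]
    rw [ih _ hG.deriv, iteratedDeriv_succ', Fin.prod_univ_castSucc]
    simp [L, Fin.init, mul_assoc]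

/-- The Laplacian of `Defs` agrees with Mathlib's one, so `h` is harmonic in Mathlib's sense. -/
lemma harmonicAt_of_fLap (h : ℝ × ℝ → ℝ) (hs : ContDiffAt ℝ (⊤ : ℕ∞) h 0)
    (hharm : fLap h =ᶠ[nhds 0] 0) :
    InnerProductSpace.HarmonicAt (h ∘ Complex.equivRealProdCLM) 0 := by
  have e0 : Complex.equivRealProdCLM 0 = 0 := map_zero _
  have hs2 : ContDiffAt ℝ 2 h 0 := hs.of_le (WithTop.coe_le_coe.2 (le_top (a := (2 : ℕ∞))))
  refine ⟨?_, ?_⟩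
  · apply ContDiffAt.comp
    · rw [e0]; exact hs2
    · exact Complex.equivRealProdCLM.contDiff.contDiffAt
  · have hev : ∀ᶠ p in 𝓝 (0 : ℝ × ℝ), ContDiffAt ℝ 2 h p := hs2.eventually (by simp)
    have ht : Tendsto Complex.equivRealProdCLM (𝓝 0) (𝓝 (0 : ℝ × ℝ)) := by
      have := Complex.equivRealProdCLM.continuous.tendsto 0
      rwa [e0] at this
    rw [InnerProductSpace.laplacian_eq_iteratedFDeriv_complexPlane]
    filter_upwards [ht.eventually hev, ht.eventually hharm] with z hz hz'
    have hdd : DifferentiableAt ℝ (fderiv ℝ h) (Complex.equivRealProdCLM z) :=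
      (hz.fderiv_right (m := 1) (by norm_num)).differentiableAt (by norm_num)
    have key : ∀ w : ℝ × ℝ, pdv w (pdv w h) (Complex.equivRealProdCLM z) =
        fderiv ℝ (fderiv ℝ h) (Complex.equivRealProdCLM z) w w := by
      intro w
      have : pdv w h = fun q => fderiv ℝ h q w := rfl
      rw [this, pdv, fderiv_clm_apply hdd (by fun_prop)]
      simp
    simp only [fLap, key, Pi.zero_apply] at hz'
    simp only [iteratedFDeriv_comp_cle]
    simpa [iteratedFDeriv_two_apply] using hz'

/-- A nonvanishing holomorphic germ has a holomorphic `k`-th root. -/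
lemma exists_root (k : ℕ) (hk : 1 ≤ k) (g : ℂ → ℂ) (hg : AnalyticAt ℂ g 0) (h0 : g 0 ≠ 0) :
    ∃ c : ℂ → ℂ, AnalyticAt ℂ c 0 ∧ c 0 ≠ 0 ∧ ∀ᶠ z in 𝓝 0, c z ^ k = g z := by
  have hk0 : k ≠ 0 := by omega
  have ha : ∀ w : ℂ, (w ^ ((k : ℂ)⁻¹)) ^ k = w := fun w => Complex.cpow_nat_inv_pow w hk0
  have hc : ∀ z, (g 0 ^ ((k : ℂ)⁻¹) * (g z / g 0) ^ ((k : ℂ)⁻¹)) ^ k = g z := by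
    intro z
    rw [mul_pow, ha, ha, mul_div_cancel₀ _ h0]
  refine ⟨fun z => g 0 ^ ((k : ℂ)⁻¹) * (g z / g 0) ^ ((k : ℂ)⁻¹), ?_, ?_, .of_forall hc⟩
  · refine analyticAt_const.mul (AnalyticAt.cpow (hg.div analyticAt_const h0) analyticAt_const ?_)
    simp [h0]
  · intro h
    have := hc 0
    simp only [h, zero_pow hk0] at this
    exact h0 this.symm

end HarmonicHelpers

/-- A smooth harmonic germ `h : (ℝ²,0) → (ℝ,0)` of order exactly `k ≥ 1`
is right equivalent to `f_k = Re((x+iy)^k)`. -/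
theorem harmonic_germ_right_equivalent_fk
    (k : ℕ) (hk : 1 ≤ k) (h : ℝ × ℝ → ℝ) (hs : ContDiffAt ℝ (⊤ : ℕ∞) h 0)
    (hharm : fLap h =ᶠ[nhds 0] 0)
    (hlow : ∀ j, j < k → iteratedFDeriv ℝ j h 0 = 0)
    (hord : iteratedFDeriv ℝ k h 0 ≠ 0) :
    RightEquiv (fkFun k) h := by
  set e := Complex.equivRealProdCLM with he
  have e0 : e 0 = 0 := map_zero _
  have es0 : e.symm 0 = 0 := map_zero _
  have hH := harmonicAt_of_fLap h hs hharm
  obtain ⟨R, hR, hball⟩ := Metric.eventually_nhds_iff_ball.1 hH.eventually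
  obtain ⟨F, hFan, hFre⟩ :=
    InnerProductSpace.HarmonicOnNhd.exists_analyticOnNhd_ball_re_eq (f := h ∘ e) hball
  have h00 : h 0 = 0 := by
    have := congrArg (fun m => m 0) (hlow 0 (by omega))
    simpa using this
  -- normalise the imaginary part
  obtain ⟨G, hG, hG0, hGre⟩ : ∃ G : ℂ → ℂ, AnalyticAt ℂ G 0 ∧ G 0 = 0 ∧
      Complex.reCLM ∘ G =ᶠ[𝓝 0] h ∘ e := by
    have hm : (0 : ℂ) ∈ Metric.ball (0 : ℂ) R := Metric.mem_ball_self hR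
    refine ⟨fun z => F z - F 0, (hFan 0 hm).sub analyticAt_const, by simp, ?_⟩
    have hF0 : (F 0).re = 0 := by
      have := hFre hm
      simpa [e0, h00] using this
    filter_upwards [Metric.ball_mem_nhds (0 : ℂ) hR] with z hz
    have := hFre hz
    simp only [Function.comp_apply] at this
    simp [hF0, this]
  have hform : ∀ j, ∀ v : Fin j → ℂ,
      iteratedFDeriv ℝ j (h ∘ e) 0 v = (iteratedDeriv j G 0 * ∏ i, v i).re := by
    intro j v
    have hd : ContDiffAt ℝ j G 0 := hG.contDiffAt.restrict_scalars ℝ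
    rw [← (hGre.iteratedFDeriv ℝ j).eq_of_nhds, Complex.reCLM.iteratedFDeriv_comp_left hd le_rfl]
    simp only [ContinuousLinearMap.compContinuousMultilinearMap_coe, Function.comp_apply]
    rw [iteratedFDeriv_holo j G hG]
    rfl
  have hGlow : ∀ j < k, iteratedDeriv j G 0 = 0 := by
    intro j hj
    cases j with
    | zero => simpa using hG0
    | succ j =>
      have hz : ∀ v : Fin (j + 1) → ℂ, (iteratedDeriv (j + 1) G 0 * ∏ i, v i).re = 0 := by
        intro v
        rw [← hform, iteratedFDeriv_comp_cle, e0, hlow _ hj]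
        rfl
      have h1 := hz (Fin.cons 1 fun _ => 1)
      have h2 := hz (Fin.cons Complex.I fun _ => 1)
      simp only [Fin.prod_univ_succ, Fin.cons_zero, Fin.cons_succ, Finset.prod_const_one,
        mul_one] at h1 h2
      apply Complex.ext
      · simpa using h1
      · simpa using h2
  have hGk : iteratedDeriv k G 0 ≠ 0 := by
    intro hz
    apply hord
    have h1 : iteratedFDeriv ℝ k (h ∘ e) 0 = 0 := by
      ext v
      rw [hform, hz]
      simp
    have h2 : (h ∘ e) ∘ e.symm = h := by
      ext p; simp
    rw [← h2, iteratedFDeriv_comp_cle e.symm, es0, h1]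
    rfl
  obtain ⟨g, hg, hg0, hgeq⟩ := hG.analyticOrderAt_eq_natCast.1
    ((analyticOrderAt_eq_nat_iff_iteratedDeriv_eq_zero hG).2 ⟨hGlow, hGk⟩)
  obtain ⟨c, hc, hc0, hceq⟩ := exists_root k hk g hg hg0
  let P : ℂ → ℂ := fun z => z * c z
  have hP : AnalyticAt ℂ P 0 := analyticAt_id.mul hc
  have hP0 : P 0 = 0 := by simp [P]
  have hPk : ∀ᶠ z in 𝓝 0, P z ^ k = G z := by
    filter_upwards [hgeq, hceq] with z h1 h2
    simp [P, mul_pow, h1, h2]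
  have hPd : deriv P 0 ≠ 0 := by
    have : HasDerivAt P (1 * c 0 + 0 * deriv c 0) 0 :=
      (hasDerivAt_id (0 : ℂ)).mul hc.differentiableAt.hasDerivAt
    rw [this.deriv]
    simpa using hc0
  obtain ⟨Q, hQ, hQP, hPQ⟩ : ∃ Q : ℂ → ℂ, AnalyticAt ℂ Q 0 ∧ (∀ᶠ z in 𝓝 0, Q (P z) = z) ∧
      (∀ᶠ z in 𝓝 0, P (Q z) = z) := by
    have h1 := hP.analyticAt_localInverse hPd
    have h2 := hP.hasStrictDerivAt.eventually_left_inverse hPd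
    have h3 := hP.hasStrictDerivAt.eventually_right_inverse hPd
    rw [hP0] at h1 h3
    exact ⟨_, h1, h2, h3⟩
  have hQ0 : Q 0 = 0 := by
    have := hQP.self_of_nhds
    rwa [hP0] at this
  have hts : Tendsto e.symm (𝓝 0) (𝓝 (0 : ℂ)) := by
    have := e.symm.continuous.tendsto 0
    rwa [es0] at this
  have hsm : ∀ A : ℂ → ℂ, AnalyticAt ℂ A 0 →
      ContDiffAt ℝ (⊤ : ℕ∞) (fun p => e (A (e.symm p))) 0 := by
    intro A hA
    have h1 : ContDiffAt ℝ (⊤ : ℕ∞) A (e.symm 0) := by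
      rw [es0]; exact hA.contDiffAt.restrict_scalars ℝ
    exact e.contDiff.contDiffAt.comp _ (h1.comp _ e.symm.contDiff.contDiffAt)
  refine ⟨fun p => e (P (e.symm p)), fun p => e (Q (e.symm p)), hsm P hP, hsm Q hQ,
    by simp [hP0], by simp [hQ0], ?_, ?_, ?_⟩
  · filter_upwards [hts.eventually hQP] with p hp
    simp [hp]
  · filter_upwards [hts.eventually hPQ] with p hp
    simp [hp]
  · filter_upwards [hts.eventually hPk, hts.eventually hGre] with p hp hp'
    have h3 : ∀ z : ℂ, fkFun k (e z) = (z ^ k).re := by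
      intro z
      simp [fkFun, he, Complex.re_add_im]
    simp only [Function.comp_apply, e.apply_symm_apply, Complex.reCLM_apply] at hp' ⊢
    rw [h3, hp, hp']
end

section
/- Let k ≥ 1 be a natural number, let h_k be a nonzero homogeneous harmonic polynomial of degree k in the real variables x, y, and let R ∈ m₂^{k+1}. Then the germ h_k + R is max(k, 2k−4)-determined: for every germ S ∈ m₂^{max(k,2k−4)+1}, the germs h_k + R and h_k + R + S are right equivalent. -/
open MvPolynomial Filter Topology

open scoped ContDiff ComplexConjugate

/-- The `n`-th power of the ideal generated by `ζ` and its conjugate, in the ring of germs of smooth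
complex-valued functions at `p₀`. -/
def InI {P : Type} [NormedAddCommGroup P] [NormedSpace ℝ P] (ζ : P → ℂ) (p₀ : P) :
    ℕ → (P → ℂ) → Prop
  | 0, F => ContDiffAt ℝ ∞ F p₀
  | n + 1, F => ∃ A B, InI ζ p₀ n A ∧ InI ζ p₀ n B ∧
      F =ᶠ[𝓝 p₀] fun p => ζ p * A p + conj (ζ p) * B p

section InI

variable {P : Type} [NormedAddCommGroup P] [NormedSpace ℝ P] {ζ : P → ℂ} {p₀ : P}

theorem contDiffAt_conj {F : P → ℂ} (h : ContDiffAt ℝ ∞ F p₀) :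
    ContDiffAt ℝ ∞ (fun p => conj (F p)) p₀ :=
  Complex.conjCLE.contDiff.contDiffAt.comp p₀ h

theorem InI.congr {n : ℕ} {F F' : P → ℂ} (h : InI ζ p₀ n F) (e : F' =ᶠ[𝓝 p₀] F) :
    InI ζ p₀ n F' := by
  cases n with
  | zero => exact ContDiffAt.congr_of_eventuallyEq h e
  | succ n =>
    obtain ⟨A, B, hA, hB, h⟩ := h
    exact ⟨A, B, hA, hB, e.trans h⟩

theorem InI.smooth (hζ : ContDiffAt ℝ ∞ ζ p₀) {n : ℕ} {F : P → ℂ} (h : InI ζ p₀ n F) :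
    ContDiffAt ℝ ∞ F p₀ := by
  induction n generalizing F with
  | zero => exact h
  | succ n ih =>
    obtain ⟨A, B, hA, hB, h⟩ := h
    exact ((hζ.mul (ih hA)).add ((contDiffAt_conj hζ).mul (ih hB))).congr_of_eventuallyEq h

theorem InI.add {n : ℕ} {F G : P → ℂ} (hF : InI ζ p₀ n F) (hG : InI ζ p₀ n G) :
    InI ζ p₀ n (fun p => F p + G p) := by
  induction n generalizing F G with
  | zero => exact ContDiffAt.add hF hG
  | succ n ih =>
    obtain ⟨A, B, hA, hB, h⟩ := hF
    obtain ⟨A', B', hA', hB', h'⟩ := hG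
    refine ⟨_, _, ih hA hA', ih hB hB', ?_⟩
    filter_upwards [h, h'] with p hp hp'
    rw [hp, hp']; ring

theorem InI.zero {n : ℕ} : InI ζ p₀ n (fun _ => 0) := by
  induction n with
  | zero => exact contDiffAt_const
  | succ n ih => exact ⟨_, _, ih, ih, by simp⟩

theorem InI.sum {ι : Type} {n : ℕ} (s : Finset ι) {F : ι → P → ℂ} (h : ∀ i, InI ζ p₀ n (F i)) :
    InI ζ p₀ n (fun p => ∑ i ∈ s, F i p) := by
  classical
  induction s using Finset.induction_on with
  | empty => simpa using InI.zero
  | insert a s ha ih => simpa [Finset.sum_insert ha] using (h a).add ih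

theorem InI.mono_succ (hζ : ContDiffAt ℝ ∞ ζ p₀) {n : ℕ} {F : P → ℂ} (h : InI ζ p₀ (n + 1) F) :
    InI ζ p₀ n F := by
  induction n generalizing F with
  | zero => exact InI.smooth hζ h
  | succ n ih =>
    obtain ⟨A, B, hA, hB, h⟩ := h
    exact ⟨A, B, ih hA, ih hB, h⟩

theorem InI.mono (hζ : ContDiffAt ℝ ∞ ζ p₀) {m n : ℕ} (hmn : m ≤ n) {F : P → ℂ}
    (h : InI ζ p₀ n F) : InI ζ p₀ m F := by
  induction hmn with
  | refl => exact h
  | step _ ih => exact ih (h.mono_succ hζ)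

theorem InI.smul {n : ℕ} {F G : P → ℂ} (hF : ContDiffAt ℝ ∞ F p₀) (hG : InI ζ p₀ n G) :
    InI ζ p₀ n (fun p => F p * G p) := by
  induction n generalizing G with
  | zero => exact ContDiffAt.mul hF hG
  | succ n ih =>
    obtain ⟨A, B, hA, hB, h⟩ := hG
    refine ⟨_, _, ih hA, ih hB, ?_⟩
    filter_upwards [h] with p hp
    rw [hp]; ring

theorem InI.mul (hζ : ContDiffAt ℝ ∞ ζ p₀) {m n : ℕ} {F G : P → ℂ} (hF : InI ζ p₀ m F)
    (hG : InI ζ p₀ n G) : InI ζ p₀ (m + n) (fun p => F p * G p) := by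
  induction m generalizing F with
  | zero => rw [Nat.zero_add]; exact InI.smul hF hG
  | succ m ih =>
    obtain ⟨A, B, hA, hB, h⟩ := hF
    rw [Nat.succ_add]
    refine ⟨_, _, ih hA, ih hB, ?_⟩
    filter_upwards [h] with p hp
    rw [hp]; ring

theorem InI.conj {n : ℕ} {F : P → ℂ} (h : InI ζ p₀ n F) :
    InI ζ p₀ n (fun p => conj (F p)) := by
  induction n generalizing F with
  | zero => exact contDiffAt_conj h
  | succ n ih =>
    obtain ⟨A, B, hA, hB, h⟩ := h
    refine ⟨_, _, ih hB, ih hA, ?_⟩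
    filter_upwards [h] with p hp
    rw [hp]; simp; ring

theorem InI.neg {n : ℕ} {F : P → ℂ} (h : InI ζ p₀ n F) : InI ζ p₀ n (fun p => - F p) := by
  have := InI.smul (contDiffAt_const (c := (-1 : ℂ))) h
  simpa using this

theorem InI.sub {n : ℕ} {F G : P → ℂ} (hF : InI ζ p₀ n F) (hG : InI ζ p₀ n G) :
    InI ζ p₀ n (fun p => F p - G p) := by
  simpa [sub_eq_add_neg] using hF.add hG.neg

theorem InI.self : InI ζ p₀ 1 ζ :=
  ⟨fun _ => 1, fun _ => 0, contDiffAt_const, contDiffAt_const, by simp⟩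

theorem InI.pow_self (hζ : ContDiffAt ℝ ∞ ζ p₀) (n : ℕ) : InI ζ p₀ n (fun p => ζ p ^ n) := by
  induction n with
  | zero =>
    simp only [pow_zero]
    exact (contDiffAt_const : ContDiffAt ℝ ∞ (fun _ : P => (1 : ℂ)) p₀)
  | succ n ih => simpa [pow_succ] using InI.mul hζ ih InI.self

theorem InI.pow_conj (hζ : ContDiffAt ℝ ∞ ζ p₀) (n : ℕ) :
    InI ζ p₀ n (fun p => (starRingEnd ℂ) (ζ p) ^ n) := by
  simpa using (InI.pow_self hζ n).conj

theorem InI.comp {Q : Type} [NormedAddCommGroup Q] [NormedSpace ℝ Q] {q₀ : Q} {g : Q → P}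
    (hg : ContDiffAt ℝ ∞ g q₀) (hgq : g q₀ = p₀) {n : ℕ} {F : P → ℂ} (h : InI ζ p₀ n F) :
    InI (fun q => ζ (g q)) q₀ n (fun q => F (g q)) := by
  subst hgq
  induction n generalizing F with
  | zero => exact ContDiffAt.comp q₀ h hg
  | succ n ih =>
    obtain ⟨A, B, hA, hB, h⟩ := h
    exact ⟨_, _, ih hA, ih hB, hg.continuousAt.eventually h⟩

/-- Real parts of elements of `I^(m+d+e)` are real parts of `ζ^m` times combinations of the
degree-`d` monomials, with coefficients in `I^e`. -/
theorem InI.rep_mono (m d e : ℕ) (hmd : m ≤ d + 1) {a b : ℕ} (hab : a + b = m + d)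
    {F : P → ℂ} (hF : InI ζ p₀ e F) :
    ∃ E : Fin (d + 1) → P → ℂ, (∀ j, InI ζ p₀ e (E j)) ∧ ∀ p,
      (ζ p ^ a * (starRingEnd ℂ) (ζ p) ^ b * F p).re =
        (ζ p ^ m * ∑ j : Fin (d + 1),
          ζ p ^ (d - (j : ℕ)) * (starRingEnd ℂ) (ζ p) ^ (j : ℕ) * E j p).re := by
  classical
  have key : ∀ (j₀ : Fin (d + 1)) (G : P → ℂ), InI ζ p₀ e G → ∃ E : Fin (d + 1) → P → ℂ,
      (∀ j, InI ζ p₀ e (E j)) ∧ ∀ p, ∑ j : Fin (d + 1),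
          ζ p ^ (d - (j : ℕ)) * (starRingEnd ℂ) (ζ p) ^ (j : ℕ) * E j p
          = ζ p ^ (d - (j₀ : ℕ)) * (starRingEnd ℂ) (ζ p) ^ (j₀ : ℕ) * G p := by
    intro j₀ G hG
    refine ⟨fun j => if j = j₀ then G else fun _ => 0, fun j => ?_, fun p => ?_⟩
    · by_cases h : j = j₀
      · simpa [h] using hG
      · simpa [h] using InI.zero
    · rw [Finset.sum_eq_single j₀]
      · simp
      · intro j _ hj; simp [hj]
      · simp
  by_cases hb : b ≤ d
  · obtain ⟨E, hE, h⟩ := key ⟨b, by omega⟩ F hF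
    refine ⟨E, hE, fun p => ?_⟩
    rw [h p]
    have : a = m + (d - b) := by omega
    have e1 : ζ p ^ a = ζ p ^ m * ζ p ^ (d - b) := by rw [this, pow_add]
    rw [e1]
    congr 1
    dsimp only
    ring
  · obtain ⟨E, hE, h⟩ := key ⟨a, by omega⟩ _ hF.conj
    refine ⟨E, hE, fun p => ?_⟩
    rw [h p]
    have : b = m + (d - a) := by omega
    have e1 : ζ p ^ b = ζ p ^ m * ζ p ^ (d - a) := by rw [this, pow_add]
    rw [← Complex.conj_re]
    congr 1
    simp only [map_mul, map_pow, Complex.conj_conj]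
    rw [e1]
    ring

theorem InI.rep (m d e : ℕ) (hmd : m ≤ d + 1) {n a b : ℕ} (hab : a + b + n = m + d)
    {F : P → ℂ} (hF : InI ζ p₀ (e + n) F) :
    ∃ E : Fin (d + 1) → P → ℂ, (∀ j, InI ζ p₀ e (E j)) ∧ ∀ᶠ p in 𝓝 p₀,
      (ζ p ^ a * (starRingEnd ℂ) (ζ p) ^ b * F p).re =
        (ζ p ^ m * ∑ j : Fin (d + 1),
          ζ p ^ (d - (j : ℕ)) * (starRingEnd ℂ) (ζ p) ^ (j : ℕ) * E j p).re := by
  induction n generalizing a b F with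
  | zero =>
    obtain ⟨E, hE, h⟩ := InI.rep_mono m d e hmd (a := a) (b := b) (by omega) hF
    exact ⟨E, hE, Eventually.of_forall h⟩
  | succ n ih =>
    obtain ⟨A, B, hA, hB, h⟩ := hF
    obtain ⟨E, hE, h1⟩ := ih (a := a + 1) (b := b) (by omega) hA
    obtain ⟨E', hE', h2⟩ := ih (a := a) (b := b + 1) (by omega) hB
    refine ⟨fun j p => E j p + E' j p, fun j => (hE j).add (hE' j), ?_⟩
    filter_upwards [h, h1, h2] with p hp h1 h2
    have e1 : ζ p ^ a * (starRingEnd ℂ) (ζ p) ^ b * F p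
      = ζ p ^ (a + 1) * (starRingEnd ℂ) (ζ p) ^ b * A p
        + ζ p ^ a * (starRingEnd ℂ) (ζ p) ^ (b + 1) * B p := by rw [hp]; ring
    rw [e1, Complex.add_re, h1, h2, ← Complex.add_re, ← mul_add, ← Finset.sum_add_distrib]
    simp only [mul_add]

end InI

section Harmonic

/-- A point of the plane as a complex number. -/
noncomputable def ze (x : ℝ × ℝ) : ℂ := ⟨x.1, x.2⟩

theorem pderiv_swap (i j : Fin 2) (p : MvPolynomial (Fin 2) ℝ) :
    pderiv i (pderiv j p) = pderiv j (pderiv i p) := by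
  have : ⁅pderiv (R := ℝ) i, pderiv (R := ℝ) j⁆ = 0 := by
    apply MvPolynomial.derivation_ext
    intro l
    rw [Derivation.commutator_apply]
    simp [pderiv_X, Pi.single_apply, apply_ite]
  have h := congrArg (fun D => D p) this
  simp only [Derivation.commutator_apply, Derivation.zero_apply] at h
  exact sub_eq_zero.mp h

theorem cr_eq (n : ℕ) (u v : MvPolynomial (Fin 2) ℝ) (hu : u.IsHomogeneous n)
    (hv : v.IsHomogeneous n) (h1 : pderiv 0 u = pderiv 1 v) (h2 : pderiv 1 u = - pderiv 0 v) :
    ∃ c : ℂ, ∀ x, (⟨toFun2 u x, toFun2 v x⟩ : ℂ) = c * ze x ^ n := by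
  induction n generalizing u v with
  | zero =>
    have hu' := hu.totalDegree_le
    have hv' := hv.totalDegree_le
    rw [Nat.le_zero, totalDegree_eq_zero_iff_eq_C] at hu' hv'
    refine ⟨⟨coeff 0 u, coeff 0 v⟩, fun x => ?_⟩
    rw [pow_zero, mul_one, hu', hv']
    simp [toFun2]
  | succ n ih =>
    obtain ⟨c, hc⟩ := ih (pderiv 0 u) (pderiv 0 v) (by simpa using hu.pderiv (i := 0))
      (by simpa using hv.pderiv (i := 0)) (by rw [h1, pderiv_swap])
      (by rw [← map_neg, ← h2, pderiv_swap])
    refine ⟨c / (n + 1), fun x => ?_⟩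
    have eu := congrArg (fun p => toFun2 p x) hu.sum_X_mul_pderiv
    have ev := congrArg (fun p => toFun2 p x) hv.sum_X_mul_pderiv
    have hcx := hc x
    rw [Fin.sum_univ_two, h2] at eu
    rw [Fin.sum_univ_two, ← h1] at ev
    simp only [toFun2, map_add, map_mul, map_neg, eval_X, map_nsmul] at eu ev hcx ⊢
    simp at eu ev
    have hn : (n + 1 : ℂ) ≠ 0 := by exact_mod_cast Nat.succ_ne_zero n
    have : c / (n + 1) * ze x ^ (n + 1) = (ze x * (c * ze x ^ n)) / (n + 1) := by
      rw [pow_succ]; ring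
    rw [this, eq_div_iff hn, ← hcx]
    apply Complex.ext
    · simp [ze]; linarith
    · simp [ze]; linarith

theorem harmonic_form (m : ℕ) (h : MvPolynomial (Fin 2) ℝ) (hne : h ≠ 0)
    (hhom : h.IsHomogeneous (m + 1)) (hharm : pLap h = 0) :
    ∃ c : ℂ, c ≠ 0 ∧ ∀ x, toFun2 h x = (c * ze x ^ (m + 1)).re := by
  obtain ⟨c, hc⟩ := cr_eq m (pderiv 0 h) (- pderiv 1 h) (by simpa using hhom.pderiv (i := 0))
    (by simpa using (hhom.pderiv (i := 1)).neg)
    (by rw [map_neg]; exact eq_neg_of_add_eq_zero_left hharm)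
    (by rw [map_neg, neg_neg, pderiv_swap])
  have key : ∀ x, toFun2 h x = (c / (m + 1) * ze x ^ (m + 1)).re := by
    intro x
    have eu := congrArg (fun p => toFun2 p x) hhom.sum_X_mul_pderiv
    have hcx := hc x
    rw [Fin.sum_univ_two] at eu
    simp only [toFun2, map_add, map_mul, map_neg, eval_X, map_nsmul] at eu hcx ⊢
    simp at eu
    have hn : (m + 1 : ℝ) ≠ 0 := by positivity
    have : c / (m + 1) * ze x ^ (m + 1) = (ze x * (c * ze x ^ m)) / ((m + 1 : ℝ) : ℂ) := by
      rw [pow_succ]; push_cast; ring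
    rw [this, ← hcx, Complex.div_ofReal_re, eq_div_iff hn]
    simp [ze]; linarith
  refine ⟨_, ?_, key⟩
  intro h0
  apply hne
  apply MvPolynomial.funext
  intro y
  have := key (y 0, y 1)
  rw [h0] at this
  simp only [toFun2, zero_mul, Complex.zero_re] at this
  rw [map_zero, ← this]
  congr 1
  congr 1
  ext i
  fin_cases i <;> rfl

end Harmonic

section Param

variable {P : Type} [NormedAddCommGroup P] [NormedSpace ℝ P] [ProperSpace P]

theorem param_bound {F : Type} [NormedAddCommGroup F] {g : P × ℝ → F} {U : Set P}
    {p : P} (hU : U ∈ 𝓝 p) (hg : ContinuousOn g (U ×ˢ Set.Icc 0 1)) :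
    ∃ s ∈ 𝓝 p, s ⊆ U ∧ ∃ C, ∀ q ∈ s, ∀ t ∈ Set.Icc (0 : ℝ) 1, ‖g (q, t)‖ ≤ C := by
  obtain ⟨ε, hε, hεU⟩ := Metric.nhds_basis_closedBall.mem_iff.mp hU
  refine ⟨Metric.closedBall p ε, Metric.closedBall_mem_nhds p hε, hεU, ?_⟩
  obtain ⟨C, hC⟩ := ((isCompact_closedBall p ε).prod isCompact_Icc).exists_bound_of_continuousOn
    (hg.mono (Set.prod_mono hεU (subset_refl (Set.Icc (0 : ℝ) 1))))
  exact ⟨C, fun q hq t ht => hC (q, t) ⟨hq, ht⟩⟩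

theorem param_meas {F : Type} [NormedAddCommGroup F] {g : P × ℝ → F} {U : Set P}
    {p : P} (hp : p ∈ U) (hg : ContinuousOn g (U ×ˢ Set.Icc 0 1)) :
    ContinuousOn (fun t => g (p, t)) (Set.Icc 0 1) :=
  hg.comp (by fun_prop) (fun _ ht => ⟨hp, ht⟩)

theorem param_meas' {F : Type} [NormedAddCommGroup F] {f : ℝ → F}
    (hg : ContinuousOn f (Set.Icc 0 1)) : MeasureTheory.AEStronglyMeasurable f
      (MeasureTheory.volume.restrict (Set.uIoc 0 1)) := by
  rw [Set.uIoc_of_le zero_le_one]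
  exact (hg.mono Set.Ioc_subset_Icc_self).aestronglyMeasurable measurableSet_Ioc

theorem param_contDiffOn (n : ℕ) : ∀ {F : Type} [NormedAddCommGroup F] [NormedSpace ℝ F]
    {g : P × ℝ → F} {U : Set P} {V : Set ℝ} (_ : IsOpen U) (_ : IsOpen V)
    (_ : Set.Icc 0 1 ⊆ V) (_ : ContDiffOn ℝ n g (U ×ˢ V)),
    ContDiffOn ℝ n (fun p => ∫ t in (0 : ℝ)..1, g (p, t)) U := by
  induction n with
  | zero =>
    intro F _ _ g U V hU hV hI hg
    simp only [Nat.cast_zero, contDiffOn_zero] at hg ⊢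
    have hg' := hg.mono (Set.prod_mono (subset_refl U) hI)
    intro p hp
    apply ContinuousAt.continuousWithinAt
    obtain ⟨s, hs, hsU, C, hC⟩ := param_bound (hU.mem_nhds hp) hg'
    apply intervalIntegral.continuousAt_of_dominated_interval (bound := fun _ => C)
    · filter_upwards [hU.mem_nhds hp] with q hq
      exact param_meas' (param_meas hq hg')
    · filter_upwards [hs] with q hq
      refine Eventually.of_forall fun t ht => hC q hq t ?_
      rw [Set.uIoc_of_le zero_le_one] at ht
      exact Set.Ioc_subset_Icc_self ht
    · exact intervalIntegrable_const
    · refine Eventually.of_forall fun t ht => ?_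
      rw [Set.uIoc_of_le zero_le_one] at ht
      have : ContinuousAt g (p, t) :=
        hg.continuousAt ((hU.prod hV).mem_nhds ⟨hp, hI (Set.Ioc_subset_Icc_self ht)⟩)
      exact this.comp (f := fun q => (q, t)) (by fun_prop)
  | succ n ih =>
    intro F _ _ g U V hU hV hI hg
    push_cast at hg ⊢
    have hO := hU.prod hV
    have hgd : DifferentiableOn ℝ g (U ×ˢ V) := hg.differentiableOn (by simp)
    let g' : P × ℝ → P →L[ℝ] F := fun q => (fderiv ℝ g q).comp (ContinuousLinearMap.inl ℝ P ℝ)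
    have hg's : ContDiffOn ℝ n g' (U ×ˢ V) := by
      have := ((contDiffOn_succ_iff_fderiv_of_isOpen hO).mp hg).2.2
      exact this.clm_comp contDiffOn_const
    have hg'c := hg's.continuousOn.mono (Set.prod_mono (subset_refl U) hI)
    have hgc := hg.continuousOn.mono (Set.prod_mono (subset_refl U) hI)
    have A : ∀ p ∈ U, HasFDerivAt (fun p => ∫ t in (0 : ℝ)..1, g (p, t))
        (∫ t in (0 : ℝ)..1, g' (p, t)) p := by
      intro p hp
      obtain ⟨s, hs, hsU, C, hC⟩ := param_bound (hU.mem_nhds hp) hg'c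
      apply intervalIntegral.hasFDerivAt_integral_of_dominated_of_fderiv_le
        (F := fun p t => g (p, t)) (F' := fun p t => g' (p, t)) (bound := fun _ => C) hs
      · filter_upwards [hU.mem_nhds hp] with q hq
        exact param_meas' (param_meas hq hgc)
      · apply ContinuousOn.intervalIntegrable
        rw [Set.uIcc_of_le zero_le_one]
        exact param_meas hp hgc
      · exact param_meas' (param_meas hp hg'c)
      · refine Eventually.of_forall fun t ht q hq => hC q hq t ?_
        rw [Set.uIoc_of_le zero_le_one] at ht
        exact Set.Ioc_subset_Icc_self ht
      · exact intervalIntegrable_const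
      · refine Eventually.of_forall fun t ht q hq => ?_
        rw [Set.uIoc_of_le zero_le_one] at ht
        have h1 : HasFDerivAt g (fderiv ℝ g (q, t)) (q, t) :=
          (hgd.differentiableAt (hO.mem_nhds
            ⟨hsU hq, hI (Set.Ioc_subset_Icc_self ht)⟩)).hasFDerivAt
        exact h1.comp q (hasFDerivAt_prodMk_left q t)
    rw [contDiffOn_succ_iff_fderiv_of_isOpen hU]
    refine ⟨fun p hp => (A p hp).differentiableAt.differentiableWithinAt, by simp, ?_⟩
    exact (ih hU hV hI hg's).congr fun p hp => (A p hp).fderiv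

theorem param_contDiffAt {F : Type} [NormedAddCommGroup F] [NormedSpace ℝ F]
    {g : P × ℝ → F} {p₀ : P} (hg : ∀ t ∈ Set.Icc (0 : ℝ) 1, ContDiffAt ℝ ∞ g (p₀, t)) :
    ContDiffAt ℝ ∞ (fun p => ∫ t in (0 : ℝ)..1, g (p, t)) p₀ := by
  rw [contDiffAt_infty]
  intro n
  have hO : IsOpen {q | ContDiffAt ℝ n g q} := by
    rw [isOpen_iff_eventually]
    intro q hq
    have hq' : ContDiffAt ℝ n g q := hq
    exact hq'.eventually (by simp)
  obtain ⟨U, V, hU, hV, hpU, hIV, hUV⟩ := generalized_tube_lemma (s := {p₀})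
    (t := Set.Icc (0 : ℝ) 1) isCompact_singleton isCompact_Icc hO (by
      rintro ⟨q, t⟩ ⟨hq, ht⟩
      rw [Set.mem_singleton_iff] at hq
      simp only at hq
      subst hq
      exact contDiffAt_infty.mp (hg t ht) n)
  have := param_contDiffOn n (g := g) hU hV hIV fun q hq =>
    ContDiffAt.contDiffWithinAt (show ContDiffAt ℝ n g q from hUV hq)
  exact this.contDiffAt (hU.mem_nhds (hpU rfl))

end Param

section Taylor

/-- A complex number as a point of the plane. -/
noncomputable def vec (w : ℂ) : ℝ × ℝ := (w.re, w.im)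

theorem ze_contDiff : ContDiff ℝ ∞ ze := by
  have : ze = fun x => Complex.equivRealProdCLM.symm x := by
    funext x
    apply Complex.ext <;> simp [ze]
  rw [this]
  exact Complex.equivRealProdCLM.symm.contDiff

theorem vec_contDiff : ContDiff ℝ ∞ vec := by
  have : vec = fun x => Complex.equivRealProdCLM x := by
    funext x
    simp [vec]
  rw [this]
  exact Complex.equivRealProdCLM.contDiff

theorem ze_add_vec (x : ℝ × ℝ) (w : ℂ) : ze (x + vec w) = ze x + w := by
  apply Complex.ext <;> simp [ze, vec]

theorem ze_zero : ze 0 = 0 := by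
  apply Complex.ext <;> simp [ze]

theorem decomp_s7 (x : ℝ × ℝ) (a b : ℂ) : (x.1 : ℂ) * a + (x.2 : ℂ) * b =
    ze x * (a / 2 - Complex.I * b / 2) +
      (starRingEnd ℂ) (ze x) * (a / 2 + Complex.I * b / 2) := by
  have h1 : ze x = x.1 + x.2 * Complex.I := by
    apply Complex.ext <;> simp [ze]
  rw [h1]
  simp only [map_add, map_mul, Complex.conj_ofReal, Complex.conj_I]
  linear_combination (x.2 * b : ℂ) * Complex.I_sq

theorem vec_decomp (x : ℝ × ℝ) : x = x.1 • ((1, 0) : ℝ × ℝ) + x.2 • ((0, 1) : ℝ × ℝ) := by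
  ext <;> simp

variable {P : Type} [NormedAddCommGroup P] [NormedSpace ℝ P] {p₀ : P}

theorem contDiffAt_ofReal {f : P → ℝ} (h : ContDiffAt ℝ ∞ f p₀) :
    ContDiffAt ℝ ∞ (fun p => (f p : ℂ)) p₀ :=
  Complex.ofRealCLM.contDiff.contDiffAt.comp p₀ h

theorem multilin_inI {X : P → ℝ × ℝ} (n : ℕ) :
    ∀ (Φ : P → ContinuousMultilinearMap ℝ (fun _ : Fin n => ℝ × ℝ) ℝ),
    ContDiffAt ℝ ∞ Φ p₀ →
    InI (fun p => ze (X p)) p₀ n (fun p => ((Φ p (fun _ => X p) : ℝ) : ℂ)) := by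
  induction n with
  | zero =>
    intro Φ hΦ
    have h1 := (ContinuousMultilinearMap.apply ℝ (fun _ : Fin 0 => ℝ × ℝ) ℝ
      (fun _ => (0 : ℝ × ℝ))).contDiff (n := ∞)
    have h2 : ContDiffAt ℝ ∞ (fun p => Φ p (fun _ => 0)) p₀ := h1.contDiffAt.comp p₀ hΦ
    have h3 : ∀ p, (fun _ : Fin 0 => X p) = fun _ => 0 := fun p => Subsingleton.elim _ _
    simp only [h3]
    exact contDiffAt_ofReal h2
  | succ n ih =>
    intro Φ hΦ
    have hs : ∀ v : ℝ × ℝ, ContDiffAt ℝ ∞ (fun p => (Φ p).curryLeft v) p₀ := by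
      intro v
      have h1 : ContDiff ℝ ∞ (fun Ψ : ContinuousMultilinearMap ℝ
          (fun _ : Fin (n + 1) => ℝ × ℝ) ℝ => Ψ.curryLeft) := by
        let e : ContinuousMultilinearMap ℝ (fun _ : Fin (n + 1) => ℝ × ℝ) ℝ →L[ℝ]
            ((ℝ × ℝ) →L[ℝ] ContinuousMultilinearMap ℝ (fun _ : Fin n => ℝ × ℝ) ℝ) :=
          (continuousMultilinearCurryLeftEquiv ℝ
            (fun _ : Fin (n + 1) => ℝ × ℝ) ℝ).toContinuousLinearEquiv.toContinuousLinearMap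
        exact ContinuousLinearMap.contDiff (𝕜 := ℝ)
          (E := ContinuousMultilinearMap ℝ (fun _ : Fin (n + 1) => ℝ × ℝ) ℝ)
          (F := (ℝ × ℝ) →L[ℝ] ContinuousMultilinearMap ℝ (fun _ : Fin n => ℝ × ℝ) ℝ) e
      have h2 : ContDiffAt ℝ ∞ (fun p => (Φ p).curryLeft) p₀ := h1.contDiffAt.comp p₀ hΦ
      exact h2.clm_apply contDiffAt_const
    have ha := ih _ (hs (1, 0))
    have hb := ih _ (hs (0, 1))
    refine ⟨_, _,
      (InI.smul (contDiffAt_const (c := (1 / 2 : ℂ))) ha).sub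
        (InI.smul (contDiffAt_const (c := (Complex.I / 2 : ℂ))) hb),
      (InI.smul (contDiffAt_const (c := (1 / 2 : ℂ))) ha).add
        (InI.smul (contDiffAt_const (c := (Complex.I / 2 : ℂ))) hb), ?_⟩
    refine Eventually.of_forall fun p => ?_
    have h1 : Φ p (fun _ => X p) = (Φ p).curryLeft (X p) (fun _ => X p) := by
      rw [ContinuousMultilinearMap.curryLeft_apply]
      congr 1
      funext i
      refine Fin.cases ?_ (fun i => ?_) i <;> simp
    have h2 : (Φ p).curryLeft (X p) (fun _ => X p)
        = (X p).1 * (Φ p).curryLeft (1, 0) (fun _ => X p)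
          + (X p).2 * (Φ p).curryLeft (0, 1) (fun _ => X p) := by
      conv_lhs => arg 1; rw [vec_decomp (X p)]
      rw [map_add, map_smul, map_smul]
      rfl
    dsimp only
    rw [h1, h2]
    push_cast
    rw [decomp_s7]
    ring

theorem taylor_inI {R : ℝ × ℝ → ℝ} (hR : ContDiffAt ℝ ∞ R 0) (n : ℕ) (hv : VanishTo (n + 1) R) :
    InI ze 0 (n + 1) (fun x => (R x : ℂ)) := by
  have hs : ContDiffAt ℝ ∞ (iteratedFDeriv ℝ (n + 1) R) 0 :=
    hR.iteratedFDeriv_right (by exact_mod_cast le_top)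
  let g : (ℝ × ℝ) × ℝ → ContinuousMultilinearMap ℝ (fun _ : Fin (n + 1) => ℝ × ℝ) ℝ :=
    fun q => (1 - q.2) ^ n • iteratedFDeriv ℝ (n + 1) R (0 + q.2 • q.1)
  have hg : ∀ t ∈ Set.Icc (0 : ℝ) 1, ContDiffAt ℝ ∞ g (0, t) := by
    intro t _
    have h1 : ContDiffAt ℝ ∞ (fun q : (ℝ × ℝ) × ℝ => (1 - q.2) ^ n) (0, t) := by fun_prop
    refine h1.smul ?_
    refine ContDiffAt.comp (g := iteratedFDeriv ℝ (n + 1) R) (0, t) ?_ ?_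
    · simpa using hs
    · fun_prop
  have hΦ := (param_contDiffAt hg).const_smul ((n.factorial : ℝ)⁻¹)
  refine (multilin_inI (X := fun x => x) (n + 1) _ hΦ).congr ?_
  have e1 : ∀ᶠ y in 𝓝 (0 : ℝ × ℝ), ContDiffAt ℝ ((n + 1 : ℕ) : ℕ∞ω) R y :=
    (contDiffAt_infty.mp hR (n + 1)).eventually (by simp)
  have e2 : ∀ᶠ y in 𝓝 (0 : ℝ × ℝ), ContinuousAt (iteratedFDeriv ℝ (n + 1) R) y := by
    have := (contDiffAt_infty.mp hs 1).eventually (by simp)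
    filter_upwards [this] with y hy
    exact hy.continuousAt
  obtain ⟨ε, hε, hball⟩ := Metric.eventually_nhds_iff_ball.mp (e1.and e2)
  filter_upwards [Metric.ball_mem_nhds (0 : ℝ × ℝ) hε] with y hy
  have hty : ∀ t ∈ Set.Icc (0 : ℝ) 1, 0 + t • y ∈ Metric.ball (0 : ℝ × ℝ) ε := by
    intro t ht
    rw [mem_ball_zero_iff] at hy ⊢
    rw [zero_add, norm_smul, Real.norm_of_nonneg ht.1]
    exact lt_of_le_of_lt (mul_le_of_le_one_left (norm_nonneg _) ht.2) hy
  have hT := map_add_eq_sum_add_integral_iteratedFDeriv (f := R) (n := n) (x := 0) (y := y)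
    (fun t ht => by exact_mod_cast (hball _ (hty t ht)).1)
  rw [Finset.sum_eq_zero, zero_add, zero_add] at hT
  swap
  · intro k hk
    rw [hv k (Finset.mem_range.mp hk)]
    simp
  rw [hT]
  congr 1
  have hgint : IntervalIntegrable (fun t => g (y, t)) MeasureTheory.volume 0 1 := by
    apply ContinuousOn.intervalIntegrable
    rw [Set.uIcc_of_le zero_le_one]
    intro t ht
    apply ContinuousAt.continuousWithinAt
    have h1 : ContinuousAt (fun t : ℝ => (1 - t) ^ n) t := by fun_prop
    refine h1.smul ?_
    refine ContinuousAt.comp (f := fun t : ℝ => 0 + t • y) (hball _ (hty t ht)).2 (by fun_prop)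
  have := ContinuousLinearMap.intervalIntegral_comp_comm (ContinuousMultilinearMap.apply ℝ
    (fun _ : Fin (n + 1) => ℝ × ℝ) ℝ (fun _ => y)) hgint
  simp only [ContinuousMultilinearMap.apply_apply] at this
  simp only [smul_apply]
  rw [← this]
  simp [g]

theorem shift_smooth {A : ℝ × ℝ → ℂ} (hA : ContDiffAt ℝ ∞ A 0) :
    ∃ L : (ℝ × ℝ) × (ℝ × ℝ) → (ℝ × ℝ →L[ℝ] ℂ), ContDiffAt ℝ ∞ L 0 ∧
      ∀ᶠ q in 𝓝 (0 : (ℝ × ℝ) × (ℝ × ℝ)), A (q.1 + q.2) - A q.1 = L q q.2 := by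
  have hs : ContDiffAt ℝ ∞ (fderiv ℝ A) 0 := hA.fderiv_right (by simp)
  let g : ((ℝ × ℝ) × (ℝ × ℝ)) × ℝ → (ℝ × ℝ →L[ℝ] ℂ) :=
    fun q => fderiv ℝ A (q.1.1 + q.2 • q.1.2)
  have hg : ∀ t ∈ Set.Icc (0 : ℝ) 1, ContDiffAt ℝ ∞ g (0, t) := by
    intro t _
    refine ContDiffAt.comp (g := fderiv ℝ A) (0, t) ?_ ?_
    · simpa using hs
    · fun_prop
  refine ⟨_, param_contDiffAt hg, ?_⟩
  have e1 : ∀ᶠ y in 𝓝 (0 : ℝ × ℝ), ContDiffAt ℝ ((0 + 1 : ℕ) : ℕ∞ω) A y :=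
    (contDiffAt_infty.mp hA (0 + 1)).eventually (by simp)
  have e2 : ∀ᶠ y in 𝓝 (0 : ℝ × ℝ), ContinuousAt (fderiv ℝ A) y := by
    have := (contDiffAt_infty.mp hs 1).eventually (by simp)
    filter_upwards [this] with y hy
    exact hy.continuousAt
  obtain ⟨ε, hε, hball⟩ := Metric.eventually_nhds_iff_ball.mp (e1.and e2)
  filter_upwards [Metric.ball_mem_nhds (0 : (ℝ × ℝ) × (ℝ × ℝ)) (half_pos hε)] with q hq
  have hq1 : ‖q.1‖ < ε / 2 := lt_of_le_of_lt (norm_fst_le q) (mem_ball_zero_iff.mp hq)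
  have hq2 : ‖q.2‖ < ε / 2 := lt_of_le_of_lt (norm_snd_le q) (mem_ball_zero_iff.mp hq)
  have hty : ∀ t ∈ Set.Icc (0 : ℝ) 1, q.1 + t • q.2 ∈ Metric.ball (0 : ℝ × ℝ) ε := by
    intro t ht
    rw [mem_ball_zero_iff]
    have h1 : ‖t • q.2‖ ≤ ‖q.2‖ := by
      rw [norm_smul, Real.norm_of_nonneg ht.1]
      exact mul_le_of_le_one_left (norm_nonneg _) ht.2
    have := norm_add_le q.1 (t • q.2)
    linarith
  have hT := map_add_eq_sum_add_integral_iteratedFDeriv (f := A) (n := 0) (x := q.1) (y := q.2)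
    (fun t ht => by exact_mod_cast (hball _ (hty t ht)).1)
  have hgint : IntervalIntegrable (fun t => g (q, t)) MeasureTheory.volume 0 1 := by
    apply ContinuousOn.intervalIntegrable
    rw [Set.uIcc_of_le zero_le_one]
    intro t ht
    apply ContinuousAt.continuousWithinAt
    refine ContinuousAt.comp (f := fun t : ℝ => q.1 + t • q.2) (hball _ (hty t ht)).2
      (by fun_prop)
  have := ContinuousLinearMap.intervalIntegral_comp_comm
    (ContinuousLinearMap.apply ℝ ℂ q.2) hgint
  simp only [ContinuousLinearMap.apply_apply] at this
  rw [← this, hT]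
  simp [g]

theorem shift_inI {X : P → ℝ × ℝ} (hX : ContDiffAt ℝ ∞ X p₀) (hX0 : X p₀ = 0) {w : P → ℂ} {d : ℕ}
    (hw : InI (fun p => ze (X p)) p₀ (d + 1) w) {n : ℕ} {A : ℝ × ℝ → ℂ} (hA : InI ze 0 n A) :
    InI (fun p => ze (X p)) p₀ (n + d) (fun p => A (X p + vec (w p)) - A (X p)) := by
  have hζ : ContDiffAt ℝ ∞ (fun p => ze (X p)) p₀ := ze_contDiff.contDiffAt.comp p₀ hX
  have hws : ContDiffAt ℝ ∞ w p₀ := hw.smooth hζ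
  have hw0 : w p₀ = 0 := by
    obtain ⟨A, B, _, _, h⟩ := hw
    rw [h.self_of_nhds]
    simp [hX0, ze_zero]
  have hvw : ContDiffAt ℝ ∞ (fun p => vec (w p)) p₀ := vec_contDiff.contDiffAt.comp p₀ hws
  have hvec0 : vec (w p₀) = 0 := by rw [hw0]; rfl
  induction n generalizing A with
  | zero =>
    rw [Nat.zero_add]
    apply InI.mono_succ hζ
    obtain ⟨L, hL, hAL⟩ := shift_smooth hA
    have hpair : ContDiffAt ℝ ∞ (fun p => (X p, vec (w p))) p₀ := hX.prodMk hvw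
    have hp0 : (X p₀, vec (w p₀)) = 0 := by
      simp only [hX0, hvec0]; rfl
    have hLc : ContDiffAt ℝ ∞ (fun p => L (X p, vec (w p))) p₀ := by
      refine ContDiffAt.comp (g := L) p₀ ?_ hpair
      rw [hp0]; exact hL
    have ev : ∀ᶠ p in 𝓝 p₀, A (X p + vec (w p)) - A (X p) =
        L (X p, vec (w p)) (vec (w p)) := by
      have ht : Tendsto (fun p => (X p, vec (w p))) (𝓝 p₀) (𝓝 0) := by
        have := hpair.continuousAt.tendsto
        rwa [hp0] at this
      exact ht.eventually hAL
    have ha : ContDiffAt ℝ ∞ (fun p => L (X p, vec (w p)) (1, 0)) p₀ :=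
      hLc.clm_apply contDiffAt_const
    have hb : ContDiffAt ℝ ∞ (fun p => L (X p, vec (w p)) (0, 1)) p₀ :=
      hLc.clm_apply contDiffAt_const
    have h1 : ContDiffAt ℝ ∞ (fun p => L (X p, vec (w p)) (1, 0) / 2
        - Complex.I * L (X p, vec (w p)) (0, 1) / 2) p₀ := by
      simp only [div_eq_mul_inv]
      exact (ha.mul contDiffAt_const).sub ((contDiffAt_const.mul hb).mul contDiffAt_const)
    have h2 : ContDiffAt ℝ ∞ (fun p => L (X p, vec (w p)) (1, 0) / 2
        + Complex.I * L (X p, vec (w p)) (0, 1) / 2) p₀ := by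
      simp only [div_eq_mul_inv]
      exact (ha.mul contDiffAt_const).add ((contDiffAt_const.mul hb).mul contDiffAt_const)
    refine ((InI.smul h1 hw).add (InI.smul h2 hw.conj)).congr ?_
    filter_upwards [ev] with p hp
    rw [hp]
    conv_lhs => arg 2; rw [vec_decomp (vec (w p))]
    rw [map_add, map_smul, map_smul, Complex.real_smul, Complex.real_smul, decomp_s7]
    have : ze (vec (w p)) = w p := rfl
    rw [this]
    ring
  | succ n ih =>
    obtain ⟨B, C, hB, hC, h⟩ := hA
    have hBX := hB.comp hX hX0
    have hCX := hC.comp hX hX0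
    have hB' := ih hB
    have hC' := ih hC
    have hBs := (hB'.mono hζ (Nat.le_add_right n d)).add hBX
    have hCs := (hC'.mono hζ (Nat.le_add_right n d)).add hCX
    have t1 := InI.mul hζ InI.self hB'
    have t2 := InI.mul hζ InI.self.conj hC'
    have t3 := InI.mul hζ hw hBs
    have t4 := InI.mul hζ hw.conj hCs
    rw [show 1 + (n + d) = n + 1 + d by omega] at t1 t2
    rw [show d + 1 + n = n + 1 + d by omega] at t3 t4
    refine ((t1.add t2).add (t3.add t4)).congr ?_
    have hX' : Tendsto X (𝓝 p₀) (𝓝 0) := hX0 ▸ hX.continuousAt.tendsto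
    have hXw : Tendsto (fun p => X p + vec (w p)) (𝓝 p₀) (𝓝 0) := by
      have := (hX.add hvw).continuousAt.tendsto
      simpa [hX0, hvec0] using this
    filter_upwards [hX'.eventually h, hXw.eventually h] with p h1 h2
    rw [h1, h2, ze_add_vec, map_add]
    ring

theorem pow_shift {ζ : P → ℂ} (hζ : ContDiffAt ℝ ∞ ζ p₀) {w : P → ℂ} {d : ℕ}
    (hw : InI ζ p₀ (d + 2) w) (n : ℕ) :
    InI ζ p₀ (n + d + 2) (fun p => (ζ p + w p) ^ (n + 1) - ζ p ^ (n + 1)) ∧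
    InI ζ p₀ (n + d + 3)
      (fun p => (ζ p + w p) ^ (n + 1) - ζ p ^ (n + 1) - (n + 1) * ζ p ^ n * w p) := by
  induction n with
  | zero =>
    refine ⟨?_, ?_⟩
    · simpa using hw
    · simpa using InI.zero
  | succ n ih =>
    obtain ⟨h1, h2⟩ := ih
    have t1 := InI.mul hζ h2 InI.self
    have t2 := InI.mul hζ h1 hw
    have t3 := InI.mul hζ (InI.pow_self hζ (n + 1)) hw
    have h2' : InI ζ p₀ (n + 1 + d + 3) (fun p => (ζ p + w p) ^ (n + 1 + 1) - ζ p ^ (n + 1 + 1)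
        - (((n + 1 : ℕ) : ℂ) + 1) * ζ p ^ (n + 1) * w p) := by
      refine ((t1.mono hζ (by omega)).add (t2.mono hζ (by omega))).congr ?_
      refine Eventually.of_forall fun p => ?_
      push_cast
      ring
    refine ⟨?_, h2'⟩
    refine ((h2'.mono hζ (by omega)).add (InI.smul (contDiffAt_const (c := (n + 2 : ℂ)))
      (t3.mono hζ (by omega)))).congr ?_
    refine Eventually.of_forall fun p => ?_
    push_cast
    ring

end Taylor

section Main

theorem InI.hasFDerivAt_zero {P : Type} [NormedAddCommGroup P] [NormedSpace ℝ P] {ζ : P → ℂ} {p₀ : P}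
    (hζ : ContDiffAt ℝ ∞ ζ p₀) (h0 : ζ p₀ = 0) {F : P → ℂ} (hF : InI ζ p₀ 2 F) :
    HasFDerivAt F (0 : P →L[ℝ] ℂ) p₀ := by
  obtain ⟨A, B, hA, hB, h⟩ := hF
  have h1 : (∞ : ℕ∞ω) ≠ 0 := by simp
  have z : ∀ A : P → ℂ, InI ζ p₀ 1 A → A p₀ = 0 := by
    rintro A ⟨A', B', -, -, hA⟩
    rw [hA.self_of_nhds]
    simp [h0]
  have dζ := (hζ.differentiableAt h1).hasFDerivAt
  have dζ' := ((contDiffAt_conj hζ).differentiableAt h1).hasFDerivAt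
  have dA := ((hA.smooth hζ).differentiableAt h1).hasFDerivAt
  have dB := ((hB.smooth hζ).differentiableAt h1).hasFDerivAt
  have := ((dζ.mul dA).add (dζ'.mul dB)).congr_of_eventuallyEq h
  refine this.congr_fderiv (ContinuousLinearMap.ext fun v => ?_)
  change ζ p₀ * _ + A p₀ * _ + ((starRingEnd ℂ) (ζ p₀) * _ + B p₀ * _) = 0
  simp [h0, z A hA, z B hB]

/-- Monomial combination of degree `d`. -/
noncomputable def monoSum (d : ℕ) (z : ℂ) (y : Fin (d + 1) → ℂ) : ℂ :=
  ∑ j : Fin (d + 1), z ^ (d - (j : ℕ)) * (starRingEnd ℂ) z ^ (j : ℕ) * y j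

theorem core (m d : ℕ) (hmd : m ≤ d + 1) (hd : 2 ≤ d) (c : ℂ) (hc : c ≠ 0) (R S : ℝ × ℝ → ℝ)
    (hR : InI ze 0 (m + 2) (fun x => (R x : ℂ))) (hS : InI ze 0 (m + d) (fun x => (S x : ℂ))) :
    ∃ W : ℝ × ℝ → ℂ, InI ze 0 d W ∧ ∀ᶠ x in 𝓝 (0 : ℝ × ℝ),
      (c * (ze x + W x) ^ (m + 1)).re + R (x + vec (W x)) =
        (c * ze x ^ (m + 1)).re + R x + S x := by
  have hze : ContDiffAt ℝ ∞ ze 0 := ze_contDiff.contDiffAt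
  obtain ⟨s, hs, hSs⟩ := InI.rep m d 0 hmd (n := m + d) (a := 0) (b := 0) (by omega)
    (by simpa using hS)
  have hss : ∀ j, ContDiffAt ℝ ∞ (s j) 0 := hs
  set K : ℂ := (m + 1) * c with hK
  have hK0 : K ≠ 0 := mul_ne_zero (by exact_mod_cast Nat.succ_ne_zero m) hc
  let y₀ : Fin (d + 1) → ℂ := fun j => K⁻¹ * s j 0
  let p₀ : (ℝ × ℝ) × (Fin (d + 1) → ℂ) := (0, y₀)
  have hX : ContDiffAt ℝ ∞ (Prod.fst : (ℝ × ℝ) × (Fin (d + 1) → ℂ) → ℝ × ℝ) p₀ := contDiffAt_fst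
  have hX0 : p₀.1 = 0 := rfl
  have hζ : ContDiffAt ℝ ∞ (fun p : (ℝ × ℝ) × (Fin (d + 1) → ℂ) => ze p.1) p₀ :=
    ze_contDiff.contDiffAt.comp p₀ hX
  have hyj : ∀ j, ContDiffAt ℝ ∞ (fun p : (ℝ × ℝ) × (Fin (d + 1) → ℂ) => p.2 j) p₀ := by
    intro j; fun_prop
  have hw : InI (fun p : (ℝ × ℝ) × (Fin (d + 1) → ℂ) => ze p.1) p₀ d
      (fun p => monoSum d (ze p.1) p.2) := by
    refine InI.sum _ fun j => ?_
    have h1 := InI.smul (hyj j) (InI.mul hζ (InI.pow_self hζ (d - (j : ℕ)))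
      (InI.pow_conj hζ (j : ℕ)))
    rw [show d - (j : ℕ) + (j : ℕ) = d by omega] at h1
    refine h1.congr (Eventually.of_forall fun p => ?_)
    ring
  obtain ⟨d', rfl⟩ : ∃ d', d = d' + 2 := ⟨d - 2, by omega⟩
  have hF1 := InI.smul (contDiffAt_const (c := c)) (pow_shift hζ hw m).2
  have hF2 := shift_inI hX hX0 (d := d' + 1) hw hR
  have hF := hF1.add (hF2.mono hζ (show m + d' + 3 ≤ _ by omega))
  rw [show m + d' + 3 = 1 + (m + (d' + 2)) by omega] at hF
  obtain ⟨E, hE, hFE⟩ := InI.rep m (d' + 2) 1 hmd (n := m + (d' + 2)) (a := 0) (b := 0)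
    (by omega) hF
  let f : (ℝ × ℝ) × (Fin (d' + 2 + 1) → ℂ) → (Fin (d' + 2 + 1) → ℂ) :=
    fun p j => K * p.2 j + E j p - s j p.1
  have hf : ContDiffAt ℝ ∞ f p₀ := by
    refine contDiffAt_pi.mpr fun j => ?_
    have h2 : ContDiffAt ℝ ∞ (fun p : (ℝ × ℝ) × (Fin (d' + 2 + 1) → ℂ) => s j p.1) p₀ :=
      ContDiffAt.comp (g := s j) p₀ (hss j) hX
    exact ((contDiffAt_const.mul (hyj j)).add ((hE j).smooth hζ)).sub h2
  have h1 : (∞ : ℕ∞ω) ≠ 0 := by simp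
  have hE0 : ∀ j, ∀ᶠ y in 𝓝 y₀, E j (0, y) = 0 := by
    intro j
    obtain ⟨A, B, -, -, h⟩ := hE j
    have ht : Tendsto (fun y : Fin (d' + 2 + 1) → ℂ => ((0 : ℝ × ℝ), y)) (𝓝 y₀) (𝓝 p₀) :=
      (by fun_prop : Continuous (fun y : Fin (d' + 2 + 1) → ℂ => ((0 : ℝ × ℝ), y))).tendsto y₀
    filter_upwards [ht.eventually h] with y hy
    rw [hy]
    simp [ze_zero]
  have hf0 : f p₀ = 0 := by
    funext j
    have := (hE0 j).self_of_nhds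
    simp only [f, p₀, this, y₀]
    simp [hK0]
  have hder : fderiv ℝ f p₀ ∘L .inr ℝ (ℝ × ℝ) (Fin (d' + 2 + 1) → ℂ) =
      K • ContinuousLinearMap.id ℝ (Fin (d' + 2 + 1) → ℂ) := by
    have e1 : HasFDerivAt (fun y => f (0, y))
        (fderiv ℝ f p₀ ∘L .inr ℝ (ℝ × ℝ) (Fin (d' + 2 + 1) → ℂ)) y₀ :=
      HasFDerivAt.comp (g := f) y₀ (hf.differentiableAt h1).hasFDerivAt
        (hasFDerivAt_prodMk_right (0 : ℝ × ℝ) y₀)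
    have e2 : HasFDerivAt (fun y : Fin (d' + 2 + 1) → ℂ => K • y - fun j => s j 0)
        (K • ContinuousLinearMap.id ℝ (Fin (d' + 2 + 1) → ℂ)) y₀ :=
      ((K • ContinuousLinearMap.id ℝ (Fin (d' + 2 + 1) → ℂ)).hasFDerivAt).sub_const _
    refine e1.unique (e2.congr_of_eventuallyEq ?_)
    filter_upwards [eventually_all.mpr hE0] with y hy
    funext j
    simp [f, hy j]
  have hinv : (fderiv ℝ f p₀ ∘L .inr ℝ (ℝ × ℝ) (Fin (d' + 2 + 1) → ℂ)).IsInvertible := by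
    rw [hder]
    refine ContinuousLinearMap.IsInvertible.of_inverse
      (g := K⁻¹ • ContinuousLinearMap.id ℝ (Fin (d' + 2 + 1) → ℂ)) ?_ ?_
    · ext y j <;> simp [hK0]
    · ext y j <;> simp [hK0]
  let Y := hf.implicitFunction h1 hinv
  have hY0 : Y 0 = y₀ := hf.implicitFunction_apply_self h1 hinv
  have hYs : ContDiffAt ℝ ∞ Y 0 := hf.contDiffAt_implicitFunction h1 hinv
  have hYe : ∀ᶠ x in 𝓝 (0 : ℝ × ℝ), f (x, Y x) = 0 := by
    have := hf.eventually_apply_implicitFunction h1 hinv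
    rw [hf0] at this
    exact this
  have hg : ContDiffAt ℝ ∞ (fun x => (x, Y x)) 0 := contDiffAt_id.prodMk hYs
  have hg0 : (fun x => (x, Y x)) (0 : ℝ × ℝ) = p₀ := by simp [hY0, p₀]
  refine ⟨fun x => monoSum (d' + 2) (ze x) (Y x), hw.comp hg hg0, ?_⟩
  have hgt : Tendsto (fun x => (x, Y x)) (𝓝 (0 : ℝ × ℝ)) (𝓝 p₀) := by
    have := hg.continuousAt.tendsto
    rwa [show ((0 : ℝ × ℝ), Y 0) = p₀ from hg0] at this
  filter_upwards [hYe, hgt.eventually hFE, hSs] with x hx hxF hxS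
  simp only [pow_zero, one_mul] at hxF hxS
  rw [Complex.ofReal_re] at hxS
  have hsj : ∀ j, s j x = K * Y x j + E j (x, Y x) := fun j =>
    (sub_eq_zero.mp (congrFun hx j)).symm
  have hsum : ze x ^ m * ∑ j : Fin (d' + 2 + 1),
      ze x ^ (d' + 2 - (j : ℕ)) * (starRingEnd ℂ) (ze x) ^ (j : ℕ) * s j x
      = c * ((m + 1) * ze x ^ m * monoSum (d' + 2) (ze x) (Y x)) + ze x ^ m *
        ∑ j : Fin (d' + 2 + 1),
      ze x ^ (d' + 2 - (j : ℕ)) * (starRingEnd ℂ) (ze x) ^ (j : ℕ) * E j (x, Y x) := by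
    simp only [hsj, mul_add, Finset.sum_add_distrib, monoSum]
    congr 1
    simp only [Finset.mul_sum, hK]
    refine Finset.sum_congr rfl fun j _ => ?_
    ring
  rw [hsum, Complex.add_re, ← hxF] at hxS
  rw [hxS]
  simp only [mul_sub, Complex.add_re, Complex.sub_re, Complex.ofReal_re]
  ring

end Main

/-- Let `k ≥ 1`, `h` a nonzero homogeneous harmonic polynomial of degree `k`,
and `R ∈ m₂^{k+1}` a smooth germ. Then the germ `h + R` is `max(k, 2k−4)`-determined: for every
smooth germ `S ∈ m₂^{max(k,2k−4)+1}`, the germs `h + R` and `h + R + S` are right equivalent. -/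
theorem harmonic_plus_higher_is_determined
    (k : ℕ) (hk : 1 ≤ k)
    (h : MvPolynomial (Fin 2) ℝ) (hne : h ≠ 0)
    (hhom : h.IsHomogeneous k) (hharm : pLap h = 0)
    (R : ℝ × ℝ → ℝ) (hRs : ContDiffAt ℝ (⊤ : ℕ∞) R 0) (hRm : VanishTo (k + 1) R)
    (S : ℝ × ℝ → ℝ) (hSs : ContDiffAt ℝ (⊤ : ℕ∞) S 0) (hSm : VanishTo (max k (2 * k - 4) + 1) S) :
    RightEquiv (fun q => toFun2 h q + R q) (fun q => toFun2 h q + R q + S q) := by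
  obtain ⟨m, rfl⟩ : ∃ m, k = m + 1 := ⟨k - 1, by omega⟩
  obtain ⟨c, hc, hform⟩ := harmonic_form m h hne hhom hharm
  obtain ⟨d, hd, hmd, hN⟩ : ∃ d, 2 ≤ d ∧ m ≤ d + 1 ∧
      max (m + 1) (2 * (m + 1) - 4) + 1 = m + d :=
    ⟨max (m + 1) (2 * (m + 1) - 4) + 1 - m, by omega, by omega, by omega⟩
  have hRI : InI ze 0 (m + 2) (fun x => (R x : ℂ)) := taylor_inI hRs (m + 1) hRm
  have hSI : InI ze 0 (m + d) (fun x => (S x : ℂ)) := by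
    rw [← hN]
    exact taylor_inI hSs _ hSm
  obtain ⟨W, hW, hev⟩ := core m d hmd hd c hc R S hRI hSI
  have hze : ContDiffAt ℝ ∞ ze 0 := ze_contDiff.contDiffAt
  have hW2 : InI ze 0 2 W := hW.mono hze hd
  have hWs : ContDiffAt ℝ ∞ W 0 := hW.smooth hze
  have hW0 : W 0 = 0 := by
    obtain ⟨A, B, -, -, h⟩ := hW2
    rw [h.self_of_nhds]
    simp [ze_zero]
  have hWd := InI.hasFDerivAt_zero hze ze_zero hW2
  have hn : (∞ : ℕ∞ω) ≠ 0 := by simp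
  let φ : ℝ × ℝ → ℝ × ℝ := fun x => x + vec (W x)
  have hφs : ContDiffAt ℝ ∞ φ 0 := contDiffAt_id.add (vec_contDiff.contDiffAt.comp 0 hWs)
  have hφ0 : φ 0 = 0 := by simp [φ, hW0, vec]
  have hφd : HasFDerivAt φ ((ContinuousLinearEquiv.refl ℝ (ℝ × ℝ) : (ℝ × ℝ) ≃L[ℝ] ℝ × ℝ) :
      (ℝ × ℝ) →L[ℝ] ℝ × ℝ) 0 := by
    have hv := (vec_contDiff.contDiffAt (x := W 0)).differentiableAt hn |>.hasFDerivAt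
    have h1 := (hasFDerivAt_id (𝕜 := ℝ) (0 : ℝ × ℝ)).add (hv.comp 0 hWd)
    rw [ContinuousLinearMap.comp_zero, add_zero] at h1
    exact h1
  have hst := hφs.hasStrictFDerivAt' hφd hn
  refine ⟨φ, hφs.localInverse hφd hn, hφs, ?_, hφ0, ?_, ?_, ?_, ?_⟩
  · have := hφs.to_localInverse hφd hn
    rwa [hφ0] at this
  · have := hφs.localInverse_apply_image hφd hn
    rwa [hφ0] at this
  · exact hst.eventually_left_inverse
  · have := hst.eventually_right_inverse
    rw [hφ0] at this
    exact this
  · filter_upwards [hev] with x hx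
    simp only [Function.comp_apply, hform, φ, ze_add_vec]
    exact hx
end

section
/- Let k ≥ 5 be a natural number and let h_k be a nonzero homogeneous harmonic polynomial of degree k in the real variables x, y. For each s ∈ {1, 2, …, k−4} let ρ_{k+s} be a homogeneous real polynomial of degree k+s satisfying Δ^{s+1} ρ_{k+s} = 0. Then the germs h_k and h_k + Σ_{s=1}^{k−4} ρ_{k+s} are right equivalent. -/
open MvPolynomial Filter Topology

/-- Complex coordinates `u = x + i y`, `v = x - i y`. -/
noncomputable def cplxT : MvPolynomial (Fin 2) ℝ →ₐ[ℝ] MvPolynomial (Fin 2) ℂ :=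
  aeval ![C (1/2 : ℂ) * (X 0 + X 1), C (-Complex.I/2) * (X 0 - X 1)]

lemma cplxT_pderiv0 (p : MvPolynomial (Fin 2) ℝ) :
    pderiv 0 (cplxT p) = C (1/2 : ℂ) * cplxT (pderiv 0 p) + C (-Complex.I/2) * cplxT (pderiv 1 p) := by
  induction p using MvPolynomial.induction_on with
  | C a =>
    have : cplxT (C a) = C (a : ℂ) := by
      rw [cplxT, aeval_C]; rfl
    rw [this]; simp
  | add p q hp hq => simp only [map_add, hp, hq]; ring
  | mul_X p i hp =>
    have h0 : cplxT (X 0) = C (1/2 : ℂ) * (X 0 + X 1) := by simp [cplxT]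
    have h1 : cplxT (X 1) = C (-Complex.I/2) * (X 0 - X 1) := by simp [cplxT]
    have e0 : pderiv 0 (cplxT (X 0)) = C (1/2 : ℂ) := by
      rw [h0, pderiv_C_mul]; simp [pderiv_X]
    have e1 : pderiv 0 (cplxT (X 1)) = C (-Complex.I/2) := by
      rw [h1, pderiv_C_mul]; simp [pderiv_X]
    fin_cases i
    · simp only [Fin.zero_eta, map_mul, pderiv_mul, hp, e0, map_add, pderiv_X_self, pderiv_X_of_ne (show (0 : Fin 2) ≠ 1 by decide), map_one, map_zero]
      ring
    · simp only [Fin.mk_one, map_mul, pderiv_mul, hp, e1, map_add, pderiv_X_self, pderiv_X_of_ne (show (1 : Fin 2) ≠ 0 by decide), map_one, map_zero]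
      ring

lemma cplxT_pderiv1 (p : MvPolynomial (Fin 2) ℝ) :
    pderiv 1 (cplxT p) = C (1/2 : ℂ) * cplxT (pderiv 0 p) + C (Complex.I/2) * cplxT (pderiv 1 p) := by
  induction p using MvPolynomial.induction_on with
  | C a =>
    have : cplxT (C a) = C (a : ℂ) := by
      rw [cplxT, aeval_C]; rfl
    rw [this]; simp
  | add p q hp hq => simp only [map_add, hp, hq]; ring
  | mul_X p i hp =>
    have h0 : cplxT (X 0) = C (1/2 : ℂ) * (X 0 + X 1) := by simp [cplxT]
    have h1 : cplxT (X 1) = C (-Complex.I/2) * (X 0 - X 1) := by simp [cplxT]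
    have e0 : pderiv 1 (cplxT (X 0)) = C (1/2 : ℂ) := by
      rw [h0, pderiv_C_mul]; simp [pderiv_X]
    have e1 : pderiv 1 (cplxT (X 1)) = C (Complex.I/2) := by
      rw [h1, pderiv_C_mul, map_sub, pderiv_X_self, pderiv_X_of_ne (show (0 : Fin 2) ≠ 1 by decide),
        zero_sub, ← C_1, ← C_neg, ← C_mul]
      congr 1; ring
    fin_cases i
    · simp only [Fin.zero_eta, map_mul, pderiv_mul, hp, e0, map_add, pderiv_X_self, pderiv_X_of_ne (show (0 : Fin 2) ≠ 1 by decide), map_one, map_zero]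
      ring
    · simp only [Fin.mk_one, map_mul, pderiv_mul, hp, e1, map_add, pderiv_X_self, pderiv_X_of_ne (show (1 : Fin 2) ≠ 0 by decide), map_one, map_zero]
      ring

lemma pderiv01_comm (p : MvPolynomial (Fin 2) ℝ) :
    pderiv 0 (pderiv 1 p) = pderiv 1 (pderiv 0 p) := by
  ext m
  simp only [coeff_pderiv, Finsupp.add_apply]
  rw [add_right_comm]
  simp
  ring

/-- The operator `∂_u ∂_v`. -/
noncomputable def dUV (p : MvPolynomial (Fin 2) ℂ) : MvPolynomial (Fin 2) ℂ :=
  pderiv 0 (pderiv 1 p)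

lemma dUV_C_mul (a : ℂ) (p : MvPolynomial (Fin 2) ℂ) : dUV (C a * p) = C a * dUV p := by
  simp only [dUV, pderiv_C_mul]

lemma dUV_cplxT (p : MvPolynomial (Fin 2) ℝ) :
    dUV (cplxT p) = C (1/4 : ℂ) * cplxT (pLap p) := by
  rw [dUV, cplxT_pderiv1, map_add, pderiv_C_mul, pderiv_C_mul, cplxT_pderiv0, cplxT_pderiv0,
    pLap, map_add, pderiv01_comm]
  have hI : (C Complex.I : MvPolynomial (Fin 2) ℂ) * C Complex.I = -1 := by
    rw [← C_mul, Complex.I_mul_I]; simp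
  have h1 : (C (-Complex.I/2) : MvPolynomial (Fin 2) ℂ) = - (C Complex.I * C (1/2)) := by
    rw [← C_mul, ← C_neg]; congr 1; ring
  have h2 : (C (Complex.I/2) : MvPolynomial (Fin 2) ℂ) = C Complex.I * C (1/2) := by
    rw [← C_mul]; congr 1; ring
  have h4 : (C (1/4) : MvPolynomial (Fin 2) ℂ) = C (1/2) * C (1/2) := by
    rw [← C_mul]; congr 1; norm_num
  rw [h1, h2, h4]
  linear_combination (-(C (1/2)) * C (1/2) * cplxT (pderiv 1 (pderiv 1 p))) * hI

lemma dUV_iter (j : ℕ) (p : MvPolynomial (Fin 2) ℝ) :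
    dUV^[j] (cplxT p) = C ((1/4 : ℂ)^j) * cplxT (pLap^[j] p) := by
  induction j with
  | zero => simp
  | succ j ih =>
    rw [Function.iterate_succ_apply', ih, dUV_C_mul, dUV_cplxT, Function.iterate_succ_apply',
      ← mul_assoc, ← C_mul, pow_succ]

lemma coeff_of_dUV_iter (j : ℕ) : ∀ (Q : MvPolynomial (Fin 2) ℂ), dUV^[j] Q = 0 →
    ∀ m : Fin 2 →₀ ℕ, j ≤ m 0 → j ≤ m 1 → coeff m Q = 0 := by
  induction j with
  | zero => intro Q h m _ _; simp only [Function.iterate_zero, id] at h; simp [h]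
  | succ j ih =>
    intro Q h m h0 h1
    rw [Function.iterate_succ_apply] at h
    set m' : Fin 2 →₀ ℕ := m - Finsupp.single 0 1 - Finsupp.single 1 1 with hm'
    have e : m = m' + Finsupp.single 0 1 + Finsupp.single 1 1 := by
      ext i; fin_cases i <;> simp [hm'] <;> omega
    have := ih _ h m' (by simp [hm']; omega) (by simp [hm']; omega)
    rw [dUV, coeff_pderiv, coeff_pderiv, ← e] at this
    have a : ((m' 0 : ℂ) + 1) ≠ 0 := Nat.cast_add_one_ne_zero _
    have b : ((m' 1 : ℂ) + 1) ≠ 0 := Nat.cast_add_one_ne_zero _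
    simpa [a, b] using this

lemma eval_cplxT (p : MvPolynomial (Fin 2) ℝ) (z : ℂ) :
    eval ![z, (starRingEnd ℂ) z] (cplxT p) = ((eval ![z.re, z.im] p : ℝ) : ℂ) := by
  induction p using MvPolynomial.induction_on with
  | C a =>
    have : cplxT (C a) = C (a : ℂ) := by
      rw [cplxT, aeval_C]; rfl
    rw [this]; simp
  | add p q hp hq => simp only [map_add, hp, hq]; push_cast; ring
  | mul_X p i hp =>
    rw [map_mul, map_mul, hp, map_mul, Complex.ofReal_mul]
    congr 1
    fin_cases i
    · simp [cplxT, Complex.ext_iff]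
      ring
    · simp [cplxT, Complex.ext_iff]
      ring

lemma normal_form (k s : ℕ) (p : MvPolynomial (Fin 2) ℝ)
    (hp : p.IsHomogeneous (k + s)) (hl : pLap^[s + 1] p = 0) :
    ∃ g : ℂ → ℂ, ContDiff ℝ (⊤ : ℕ∞) g ∧ (s = 0 → ∀ z, g z = g 0) ∧ (s ≠ 0 → g 0 = 0) ∧
      ∀ q : ℝ × ℝ, toFun2 p q = (Complex.equivRealProdCLM.symm q ^ k *
        g (Complex.equivRealProdCLM.symm q)).re := by
  have hQ : dUV^[s + 1] (cplxT p) = 0 := by rw [dUV_iter, hl]; simp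
  have hhom : (cplxT p).IsHomogeneous (k + s) := by
    have := hp.aeval (S := ℂ) (τ := Fin 2) (n := 1) ![C (1/2 : ℂ) * (X 0 + X 1), C (-Complex.I/2) * (X 0 - X 1)] (by
      intro i
      fin_cases i
      · exact ((isHomogeneous_X ℂ 0).add (isHomogeneous_X ℂ 1)).C_mul _
      · exact ((isHomogeneous_X ℂ 0).sub (isHomogeneous_X ℂ 1)).C_mul _)
    simpa [cplxT] using this
  have key : ∀ m : Fin 2 →₀ ℕ, ∃ g : ℂ → ℂ, m ∈ (cplxT p).support → 
      ContDiff ℝ (⊤ : ℕ∞) g ∧ (s = 0 → ∀ z, g z = g 0) ∧ (s ≠ 0 → g 0 = 0) ∧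
      ∀ z : ℂ, (coeff m (cplxT p) * (z ^ m 0 * (starRingEnd ℂ z) ^ m 1)).re = (z ^ k * g z).re := by
    intro m
    by_cases hm : m ∈ (cplxT p).support
    swap
    · exact ⟨0, fun h => absurd h hm⟩
    have hc := mem_support_iff.1 hm
    have hd : m 0 + m 1 = k + s := by
      have := hhom hc
      simpa [Finsupp.weight_apply, Finsupp.sum_fintype] using this
    have hor : k ≤ m 0 ∨ k ≤ m 1 := by
      by_contra! hcon
      exact hc (coeff_of_dUV_iter _ _ hQ m (by omega) (by omega))
    have hconj : ContDiff ℝ (⊤ : ℕ∞) (fun z : ℂ => starRingEnd ℂ z) := Complex.conjCLE.contDiff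
    rcases hor with h | h
    · refine ⟨fun z => coeff m (cplxT p) * (z ^ (m 0 - k) * (starRingEnd ℂ z) ^ m 1), fun _ => ⟨?_, ?_, ?_, ?_⟩⟩
      · fun_prop
      · intro hs z
        have a : m 0 - k = 0 := by omega
        have b : m 1 = 0 := by omega
        simp [a, b]
      · intro hs
        by_cases a : m 0 - k = 0
        · have b : m 1 ≠ 0 := by omega
          simp [b]
        · simp [a]
      · intro z
        obtain ⟨d, hd⟩ := Nat.exists_eq_add_of_le h
        congr 1
        simp only [hd, Nat.add_sub_cancel_left, pow_add]
        ring
    · refine ⟨fun z => starRingEnd ℂ (coeff m (cplxT p)) * (z ^ (m 1 - k) * (starRingEnd ℂ z) ^ m 0), fun _ => ⟨?_, ?_, ?_, ?_⟩⟩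
      · fun_prop
      · intro hs z
        have a : m 1 - k = 0 := by omega
        have b : m 0 = 0 := by omega
        simp [a, b]
      · intro hs
        by_cases a : m 1 - k = 0
        · have b : m 0 ≠ 0 := by omega
          simp [b]
        · simp [a]
      · intro z
        obtain ⟨d, hd⟩ := Nat.exists_eq_add_of_le h
        rw [← Complex.conj_re]
        congr 1
        simp only [hd, Nat.add_sub_cancel_left, pow_add, map_mul, map_pow, Complex.conj_conj]
        ring
  choose g hg using key
  refine ⟨fun z => ∑ m ∈ (cplxT p).support, g m z, ?_, ?_, ?_, ?_⟩
  · exact ContDiff.sum fun m hm => (hg m hm).1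
  · intro hs z
    exact Finset.sum_congr rfl fun m hm => (hg m hm).2.1 hs z
  · intro hs
    exact Finset.sum_eq_zero fun m hm => (hg m hm).2.2.1 hs
  · intro q
    set z := Complex.equivRealProdCLM.symm q with hz
    have h1 : toFun2 p q = (eval ![z, (starRingEnd ℂ) z] (cplxT p)).re := by
      rw [eval_cplxT, Complex.ofReal_re, toFun2]
      simp [hz]
    rw [h1, eval_eq', Complex.re_sum, Finset.mul_sum, Complex.re_sum]
    refine Finset.sum_congr rfl fun m hm => ?_
    rw [← (hg m hm).2.2.2 z]
    simp [Fin.prod_univ_two]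

lemma exists_diffeo (k : ℕ) (hk : k ≠ 0) (G : ℂ → ℂ) (hG : ContDiff ℝ (⊤ : ℕ∞) G) (h0 : G 0 = 0) :
    ∃ Φ Ψ : ℂ → ℂ, ContDiffAt ℝ (⊤ : ℕ∞) Φ 0 ∧ ContDiffAt ℝ (⊤ : ℕ∞) Ψ 0 ∧ Φ 0 = 0 ∧ Ψ 0 = 0 ∧
      (∀ᶠ z in 𝓝 0, Ψ (Φ z) = z) ∧ (∀ᶠ z in 𝓝 0, Φ (Ψ z) = z) ∧
      (∀ᶠ z in 𝓝 0, Φ z ^ k = z ^ k * (1 + G z)) := by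
  set w : ℂ → ℂ := fun z => Complex.exp (Complex.log (1 + G z) / k) with hw
  have hwc : ContDiffAt ℝ (⊤ : ℕ∞) w 0 := by
    have h1 : ContDiffAt ℝ (⊤ : ℕ∞) (fun z => 1 + G z) 0 := by fun_prop
    have h2 : ContDiffAt ℝ (⊤ : ℕ∞) Complex.log (1 + G 0) := by
      have : (1 + G 0) ∈ Complex.slitPlane := by simp [h0]
      exact (Complex.contDiffAt_log this).restrict_scalars ℝ
    have h3 := h2.comp (0 : ℂ) h1
    exact (h3.div_const _).cexp
  have hw0 : w 0 = 1 := by simp [hw, h0]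
  have hΦ : ContDiffAt ℝ (⊤ : ℕ∞) (fun z => z * w z) 0 := contDiffAt_id.mul hwc
  have hd : HasFDerivAt (fun z => z * w z) ((ContinuousLinearEquiv.refl ℝ ℂ : ℂ ≃L[ℝ] ℂ) : ℂ →L[ℝ] ℂ) 0 := by
    have h1 : HasFDerivAt w (fderiv ℝ w 0) 0 := (hwc.differentiableAt (by simp)).hasFDerivAt
    have h2 := (hasFDerivAt_id (𝕜 := ℝ) (0 : ℂ)).mul h1
    refine HasFDerivAt.congr_fderiv (f := fun z => z * w z) h2 ?_
    ext <;> simp [hw0]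
  have hn : ((⊤ : ℕ∞) : WithTop ℕ∞) ≠ 0 := by simp
  have hs := hΦ.hasStrictFDerivAt' hd hn
  have e0 : (0 : ℂ) * w 0 = 0 := zero_mul _
  refine ⟨fun z => z * w z, hΦ.localInverse hd hn, hΦ, ?_, e0, ?_, hs.eventually_left_inverse, ?_, ?_⟩
  · have := hΦ.to_localInverse hd hn
    simpa only [e0] using this
  · have := hΦ.localInverse_apply_image hd hn
    simpa only [e0] using this
  · have := hs.eventually_right_inverse
    simp only [e0] at this
    exact this
  · have hc : ContinuousAt (fun z => 1 + G z) 0 := by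
      have := hG.continuous
      fun_prop
    have : ∀ᶠ z in 𝓝 (0:ℂ), 1 + G z ≠ 0 := hc.eventually_ne (by simp [h0])
    filter_upwards [this] with z hz
    rw [mul_pow, hw, ← Complex.exp_nat_mul, mul_div_cancel₀ _ (by exact_mod_cast hk), Complex.exp_log hz]

/-- Let `k ≥ 5`, `h` a nonzero homogeneous harmonic polynomial of degree `k`,
and for each `s ∈ {1,…,k−4}` let `ρ s` be homogeneous of degree `k+s` with `Δ^{s+1}(ρ s) = 0`.
Then `h` and `h + Σ_{s=1}^{k-4} ρ s` are right equivalent as germs at `0`. -/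
theorem harmonic_plus_low_polyharmonic_right_equivalent
    (k : ℕ) (hk : 5 ≤ k)
    (h : MvPolynomial (Fin 2) ℝ) (hne : h ≠ 0)
    (hhom : h.IsHomogeneous k) (hharm : pLap h = 0)
    (ρ : ℕ → MvPolynomial (Fin 2) ℝ)
    (hρhom : ∀ s ∈ Finset.Icc 1 (k - 4), (ρ s).IsHomogeneous (k + s))
    (hρker : ∀ s ∈ Finset.Icc 1 (k - 4), pLap^[s + 1] (ρ s) = 0) :
    RightEquiv (toFun2 h)
      (fun q => toFun2 h q + ∑ s ∈ Finset.Icc 1 (k - 4), toFun2 (ρ s) q) := by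
  obtain ⟨g₀, -, hg₀, -, hh⟩ := normal_form k 0 h hhom hharm
  have hh : ∀ q : ℝ × ℝ, toFun2 h q = (Complex.equivRealProdCLM.symm q ^ k * g₀ 0).re := by
    intro q; rw [hh q, hg₀ rfl]
  set c := g₀ 0
  have hc : c ≠ 0 := by
    intro hc
    apply hne
    apply MvPolynomial.funext
    intro x
    have := hh (x 0, x 1)
    rw [hc, mul_zero, Complex.zero_re, toFun2] at this
    have e : x = ![x 0, x 1] := by ext i; fin_cases i <;> rfl
    rw [e, map_zero]; exact this
  have key : ∀ s : ℕ, ∃ g : ℂ → ℂ, s ∈ Finset.Icc 1 (k - 4) → ContDiff ℝ (⊤ : ℕ∞) g ∧ g 0 = 0 ∧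
      ∀ q : ℝ × ℝ, toFun2 (ρ s) q = (Complex.equivRealProdCLM.symm q ^ k *
        g (Complex.equivRealProdCLM.symm q)).re := by
    intro s
    by_cases hs : s ∈ Finset.Icc 1 (k - 4)
    · obtain ⟨g, h1, -, h2, h3⟩ := normal_form k s (ρ s) (hρhom s hs) (hρker s hs)
      exact ⟨g, fun _ => ⟨h1, h2 (by have := Finset.mem_Icc.1 hs; omega), h3⟩⟩
    · exact ⟨0, fun h => absurd h hs⟩
  choose g hg using key
  obtain ⟨Φ, Ψ, hΦ, hΨ, hΦ0, hΨ0, hl, hr, hpow⟩ := exists_diffeo k (by omega)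
    (fun z => (∑ s ∈ Finset.Icc 1 (k - 4), g s z) * c⁻¹)
    ((ContDiff.sum fun s hs => (hg s hs).1).mul contDiff_const)
    (by rw [Finset.sum_eq_zero fun s hs => (hg s hs).2.1, zero_mul])
  set e := Complex.equivRealProdCLM
  have ht : Tendsto e.symm (𝓝 0) (𝓝 0) := by
    have := e.symm.continuous.tendsto 0
    simpa using this
  have conj : ∀ F : ℂ → ℂ, ContDiffAt ℝ (⊤ : ℕ∞) F 0 →
      ContDiffAt ℝ (⊤ : ℕ∞) (fun q => e (F (e.symm q))) 0 := by
    intro F hF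
    have h1 : ContDiffAt ℝ (⊤ : ℕ∞) F (e.symm 0) := by simpa using hF
    exact e.contDiff.contDiffAt.comp _ (h1.comp (0 : ℝ × ℝ) e.symm.contDiff.contDiffAt)
  refine ⟨fun q => e (Φ (e.symm q)), fun q => e (Ψ (e.symm q)), conj Φ hΦ, conj Ψ hΨ,
    by simp [hΦ0], by simp [hΨ0], ?_, ?_, ?_⟩
  · filter_upwards [ht.eventually hl] with q hq
    simp [hq]
  · filter_upwards [ht.eventually hr] with q hq
    simp [hq]
  · filter_upwards [ht.eventually hpow] with q hq
    have e1 : ∑ s ∈ Finset.Icc 1 (k - 4), toFun2 (ρ s) q =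
        (e.symm q ^ k * ∑ s ∈ Finset.Icc 1 (k - 4), g s (e.symm q)).re := by
      rw [Finset.mul_sum, Complex.re_sum]
      exact Finset.sum_congr rfl fun s hs => (hg s hs).2.2 q
    rw [Function.comp_apply, hh, hh, e1, e.symm_apply_apply, hq, ← Complex.add_re]
    congr 1
    field_simp
end
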